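/- Let k be the algebraic closure of ℚ, and let Γ ≤ Aut(A²) be a finitely generated subgroup that is not of bounded degree. Then for every point p ∈ k², either the orbit Γ·p = {φ̂(p) : φ ∈ Γ} is finite, or its Zariski closure is all of k² (equivalently, the only polynomial in k[x,y] vanishing at every point of the orbit Γ·p is the zero polynomial). -/

import Mathlib

open MvPolynomial

variable {k : Type*} [Field k]

/-- The subgroup `Aff` of affine automorphisms: both components have degree `1`. -/
def IsAff (φ : MvPolynomial (Fin 2) k ≃ₐ[k] MvPolynomial (Fin 2) k) : Prop :=
  (φ (X 0)).totalDegree = 1 ∧ (φ (X 1)).totalDegree = 1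

/-- The de Jonquières subgroup `J`: automorphisms of the form
`(a x + P(y), b y + c)` with `a, b ∈ kˣ`, `c ∈ k`, `P ∈ k[y]`. -/
def IsJonq (φ : MvPolynomial (Fin 2) k ≃ₐ[k] MvPolynomial (Fin 2) k) : Prop :=
  ∃ (a b : kˣ) (c : k) (P : Polynomial k),
    φ (X 0) = C (a : k) * X 0 + Polynomial.aeval (X 1) P ∧
      φ (X 1) = C (b : k) * X 1 + C c

/-- The degree of a polynomial automorphism: the maximum of the total degrees of its two
components. -/
noncomputable def adeg (φ : MvPolynomial (Fin 2) k ≃ₐ[k] MvPolynomial (Fin 2) k) : ℕ :=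
  max (φ (X 0)).totalDegree (φ (X 1)).totalDegree

/-- The point map associated with a `k`-algebra automorphism `σ` of `k[x,y]`:
`σ̂ p = ((σ x)(p), (σ y)(p))`. -/
noncomputable def pmap (σ : MvPolynomial (Fin 2) k ≃ₐ[k] MvPolynomial (Fin 2) k)
    (p : Fin 2 → k) : Fin 2 → k :=
  fun i => eval p (σ (X i))

local notation "RR" => MvPolynomial (Fin 2) k
local notation "AA" => MvPolynomial (Fin 2) k ≃ₐ[k] MvPolynomial (Fin 2) k

section Top

/-- weight of an exponent -/
def wt (m n : ℕ) (s : Fin 2 →₀ ℕ) : ℕ := s 0 * m + s 1 * n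

/-- value at `(a,b)` of the weight-`N` part of a polynomial -/
noncomputable def tf {S : Type*} [CommRing S] [Algebra k S] (m n N : ℕ) (a b : S) : RR →ₗ[k] S :=
  (MvPolynomial.basisMonomials (Fin 2) k).constr k
    (fun s => if wt m n s = N then a ^ (s 0) * b ^ (s 1) else 0)

theorem tf_monomial {S : Type*} [CommRing S] [Algebra k S] (m n N : ℕ) (a b : S)
    (s : Fin 2 →₀ ℕ) (c : k) :
    tf m n N a b (monomial s c) = if wt m n s = N then algebraMap k S c * (a ^ (s 0) * b ^ (s 1)) else 0 := by
  have h : (monomial s c : RR) = c • (MvPolynomial.basisMonomials (Fin 2) k) s := by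
    simp [MvPolynomial.smul_monomial]
  rw [h, map_smul, tf, Module.Basis.constr_basis]
  split_ifs <;> simp [Algebra.smul_def]

theorem tf_sum {S : Type*} [CommRing S] [Algebra k S] (m n N : ℕ) (a b : S) (f : RR) :
    tf m n N a b f = ∑ s ∈ f.support, if wt m n s = N then
      algebraMap k S (coeff s f) * (a ^ (s 0) * b ^ (s 1)) else 0 := by
  conv_lhs => rw [f.as_sum]
  rw [map_sum]
  exact Finset.sum_congr rfl fun s _ => tf_monomial m n N a b s _

theorem top_monomial {S : Type*} [CommRing S] [Algebra k S] (m n N : ℕ) (u v : Polynomial S)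
    (hu : u.natDegree ≤ m) (hv : v.natDegree ≤ n) (s : Fin 2 →₀ ℕ) (c : k) (hs : wt m n s ≤ N) :
    (aeval ![u, v] (monomial s c : RR)).coeff N =
      if wt m n s = N then algebraMap k S c * ((u.coeff m) ^ (s 0) * (v.coeff n) ^ (s 1)) else 0 := by
  have h1 : aeval ![u, v] (monomial s c : RR)
      = Polynomial.C (algebraMap k S c) * (u ^ s 0 * v ^ s 1) := by
    rw [aeval_monomial, Finsupp.prod_fintype _ _ (by simp)]
    simp [Fin.prod_univ_two, Polynomial.algebraMap_apply]
  have hdu : (u ^ s 0).natDegree ≤ s 0 * m :=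
    Polynomial.natDegree_pow_le_of_le _ hu
  have hdv : (v ^ s 1).natDegree ≤ s 1 * n :=
    Polynomial.natDegree_pow_le_of_le _ hv
  rw [h1, Polynomial.coeff_C_mul]
  split_ifs with h
  · rw [← h, wt, Polynomial.coeff_mul_add_eq_of_natDegree_le hdu hdv,
      Polynomial.coeff_pow_of_natDegree_le hu,
      Polynomial.coeff_pow_of_natDegree_le hv]
  · rw [Polynomial.coeff_eq_zero_of_natDegree_lt, mul_zero]
    refine lt_of_le_of_lt (Polynomial.natDegree_mul_le_of_le hdu hdv) ?_
    exact lt_of_le_of_ne hs h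

theorem top_coeff {S : Type*} [CommRing S] [Algebra k S] (m n N : ℕ) (u v : Polynomial S)
    (hu : u.natDegree ≤ m) (hv : v.natDegree ≤ n) (f : RR) (hf : ∀ s ∈ f.support, wt m n s ≤ N) :
    (aeval ![u, v] f).coeff N = tf m n N (u.coeff m) (v.coeff n) f := by
  rw [tf_sum]
  conv_lhs => rw [f.as_sum]
  rw [map_sum, Polynomial.finsetSum_coeff]
  exact Finset.sum_congr rfl fun s hs => top_monomial m n N u v hu hv s _ (hf s hs)

theorem aeval_tf {S : Type*} [CommRing S] [Algebra k S] (m n N : ℕ) (a : k) (b : S) (f : RR) :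
    Polynomial.aeval b (tf m n N (Polynomial.C a) Polynomial.X f) = tf m n N (algebraMap k S a) b f := by
  rw [tf_sum, tf_sum, map_sum]
  refine Finset.sum_congr rfl fun s _ => ?_
  split_ifs <;> simp

theorem tf_deriv (m n N : ℕ) (a : k) (f : RR) :
    Polynomial.derivative (tf m n (N + n) (Polynomial.C a) Polynomial.X f)
      = tf m n N (Polynomial.C a) Polynomial.X (pderiv 1 f) := by
  induction f using MvPolynomial.monomial_add_induction_on with
  | C c =>
    rw [pderiv_C, map_zero, C_apply, tf_monomial]
    split_ifs <;> simp
  | monomial_add s c f _ _ ih =>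
    simp only [map_add]
    rw [ih]
    congr 1
    rw [pderiv_monomial, tf_monomial, tf_monomial]
    rcases Nat.eq_zero_or_pos (s 1) with h | h
    · simp only [h, pow_zero, mul_one, Nat.cast_zero, mul_zero, map_zero, zero_mul, ite_self]
      split_ifs <;> simp [-map_pow, ← Polynomial.C_pow]
    · have hw : wt m n s = wt m n (s - Finsupp.single 1 1) + n := by
        obtain ⟨j, hj⟩ := Nat.exists_eq_add_of_lt h
        simp [wt, hj]; ring
      simp only [hw, Nat.add_right_cancel_iff]
      split_ifs
      · simp [Polynomial.derivative_X_pow, -map_pow, ← Polynomial.C_pow]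
        ring
      · simp

theorem tf_coeff (m n N : ℕ) (hm : 0 < m) (a : k) (f : RR) (s : Fin 2 →₀ ℕ) (hs : wt m n s = N) :
    (tf m n N (Polynomial.C a) Polynomial.X f).coeff (s 1) = coeff s f * a ^ (s 0) := by
  rw [tf_sum, Polynomial.finsetSum_coeff]
  rw [Finset.sum_eq_single s]
  · simp [hs, -map_pow, ← Polynomial.C_pow]
  · intro t _ hts
    split_ifs with h
    · have : s 1 ≠ t 1 := by
        intro h1
        apply hts
        have : t 0 = s 0 := by
          rw [← hs, wt, wt, h1] at h
          exact Nat.eq_of_mul_eq_mul_right hm (by omega)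
        ext i; fin_cases i <;> simp [this, h1]
      simp [-map_pow, ← Polynomial.C_pow, Polynomial.coeff_X_pow, this]
    · simp
  · intro h
    simp [notMem_support_iff.mp h]

theorem tf_supp (m n N : ℕ) (a : k) (f : RR) (j : ℕ)
    (hj : (tf m n N (Polynomial.C a) Polynomial.X f).coeff j ≠ 0) :
    ∃ s ∈ f.support, wt m n s = N ∧ s 1 = j := by
  rw [tf_sum, Polynomial.finsetSum_coeff] at hj
  obtain ⟨s, hs, h⟩ := Finset.exists_ne_zero_of_sum_ne_zero hj
  refine ⟨s, hs, ?_⟩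
  split_ifs at h with h1
  · refine ⟨h1, ?_⟩
    by_contra h2
    apply h
    simp [-map_pow, ← Polynomial.C_pow, Polynomial.coeff_X_pow, Ne.symm h2]
  · simp at h

theorem tf_ne_zero (m n N : ℕ) (hm : 0 < m) (a : k) (ha : a ≠ 0) (f : RR) (s : Fin 2 →₀ ℕ)
    (hs : s ∈ f.support) (hw : wt m n s = N) :
    tf m n N (Polynomial.C a) Polynomial.X f ≠ 0 := by
  intro h
  have := tf_coeff m n N hm a f s hw
  rw [h] at this
  simp [ha] at this
  exact (mem_support_iff.mp hs) this

end Top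

section Jac

theorem chain_rule (σ : AA) (i : Fin 2) (u : RR) :
    pderiv i (σ u) = σ (pderiv 0 u) * pderiv i (σ (X 0)) + σ (pderiv 1 u) * pderiv i (σ (X 1)) := by
  induction u using MvPolynomial.induction_on with
  | C a =>
    have : σ (C a) = C a := σ.commutes a
    simp [this]
  | add p q hp hq => simp only [map_add, hp, hq]; ring
  | mul_X p j hp =>
    simp only [map_mul, pderiv_mul, map_add, hp]
    fin_cases j
    · simp; ring
    · simp; ring

/-- the Jacobian determinant -/
noncomputable def jac (u v : RR) : RR := pderiv 0 u * pderiv 1 v - pderiv 1 u * pderiv 0 v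

theorem jac_comp (σ : AA) (u v : RR) : jac (σ u) (σ v) = σ (jac u v) * jac (σ (X 0)) (σ (X 1)) := by
  unfold jac
  rw [chain_rule σ 0 u, chain_rule σ 1 u, chain_rule σ 0 v, chain_rule σ 1 v]
  simp only [map_sub, map_mul]
  ring

theorem jac_X : jac (X 0 : RR) (X 1) = 1 := by
  simp [jac]

theorem jac_unit (σ : AA) : IsUnit (jac (σ (X 0)) (σ (X 1))) := by
  have h := jac_comp σ (σ.symm (X 0)) (σ.symm (X 1))
  rw [AlgEquiv.apply_symm_apply, AlgEquiv.apply_symm_apply, jac_X] at h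
  exact IsUnit.of_mul_eq_one _ (by rw [mul_comm]; exact h.symm)

theorem pderiv_degree (i : Fin 2) (f : RR) (hf : pderiv i f ≠ 0) :
    (pderiv i f).totalDegree + 1 ≤ f.totalDegree := by
  obtain ⟨s, hs, hmax⟩ := Finset.exists_mem_eq_sup (pderiv i f).support
    (support_nonempty.mpr hf) (fun s => s.degree)
  have h1 : (pderiv i f).totalDegree = s.degree := hmax
  rw [h1]
  rw [mem_support_iff, coeff_pderiv] at hs
  have h2 : s + Finsupp.single i 1 ∈ f.support := by
    rw [mem_support_iff]
    intro h
    simp [h] at hs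
  have h3 := le_totalDegree h2
  have h4 : ((s + Finsupp.single i 1).sum fun _ e => e) = s.degree + 1 := by
    have : ((s + Finsupp.single i 1).sum fun _ e => e) = (s + Finsupp.single i 1).degree := rfl
    rw [this, map_add, Finsupp.degree_single]
  omega

theorem pmul_degree (i j : Fin 2) (u v : RR) (h : pderiv i u * pderiv j v ≠ 0) :
    (pderiv i u * pderiv j v).totalDegree + 2 ≤ u.totalDegree + v.totalDegree := by
  have h1 := pderiv_degree i u (left_ne_zero_of_mul h)
  have h2 := pderiv_degree j v (right_ne_zero_of_mul h)
  have h3 := totalDegree_mul (pderiv i u) (pderiv j v)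
  omega

theorem jac_degree (u v : RR) (h : jac u v ≠ 0) :
    (jac u v).totalDegree + 2 ≤ u.totalDegree + v.totalDegree := by
  unfold jac at *
  have h3 := totalDegree_sub (pderiv 0 u * pderiv 1 v) (pderiv 1 u * pderiv 0 v)
  by_cases h1 : pderiv 0 u * pderiv 1 v = 0
  · by_cases h2 : pderiv 1 u * pderiv 0 v = 0
    · simp [h1, h2] at h
    · have := pmul_degree _ _ _ _ h2
      rw [h1] at h3 ⊢
      rw [totalDegree_zero] at h3
      omega
  · have h4 := pmul_degree _ _ _ _ h1
    by_cases h2 : pderiv 1 u * pderiv 0 v = 0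
    · rw [h2] at h3 ⊢
      rw [totalDegree_zero] at h3
      omega
    · have := pmul_degree _ _ _ _ h2
      omega

theorem parachute (σ : AA) (H : RR) (hH : pderiv 1 H ≠ 0) :
    (σ (pderiv 1 H)).totalDegree + 2 ≤ (σ H).totalDegree + (σ (X 0)).totalDegree := by
  have h := jac_comp σ (X 0) H
  have h0 : jac (X 0) H = pderiv 1 H := by simp [jac]
  have hu := jac_unit σ
  have hne : σ (pderiv 1 H) ≠ 0 := by simpa using hH
  rw [h0] at h
  have h5 : (jac (σ (X 0)) (σ H)) ≠ 0 := by
    rw [h]; exact mul_ne_zero hne hu.ne_zero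
  have h6 := jac_degree _ _ h5
  rw [h, totalDegree_mul_of_isDomain hne hu.ne_zero] at h6
  omega

theorem parachute_iter (σ : AA) (μ : ℕ) (H : RR) (hH : (pderiv 1)^[μ] H ≠ 0) :
    (σ ((pderiv 1)^[μ] H)).totalDegree + 2 * μ ≤ (σ H).totalDegree + μ * (σ (X 0)).totalDegree := by
  induction μ with
  | zero => simp
  | succ μ ih =>
    rw [Function.iterate_succ_apply'] at hH ⊢
    have h1 := parachute σ _ hH
    have h2 := ih (by intro h; rw [h] at hH; simp at hH)
    rw [Nat.add_mul, one_mul]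
    omega

end Jac

section Mult

theorem mult_bound [CharZero k] (p r : ℕ) (hp : 0 < p) (g : Polynomial k) (hg : g ≠ 0)
    (hs : ∀ j ∈ g.support, ∃ i, j = r + p * i) (b : k) (hb : b ≠ 0) :
    p * g.rootMultiplicity b ≤ g.natDegree := by
  classical
  let u : Polynomial k := ∑ j ∈ g.support, Polynomial.monomial ((j - r) / p) (g.coeff j)
  have hgu : g = Polynomial.X ^ r * Polynomial.expand k p u := by
    conv_lhs => rw [g.as_sum_support]
    simp only [u, map_sum, Finset.mul_sum]
    refine Finset.sum_congr rfl fun j hj => ?_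
    obtain ⟨i, rfl⟩ := hs j hj
    rw [Polynomial.expand_monomial, Polynomial.X_pow_mul_monomial]
    rw [Nat.add_sub_cancel_left, Nat.mul_div_cancel_left _ hp, mul_comm i p]
    first | rfl | rw [add_comm]
  have hu : u ≠ 0 := by rintro h; rw [h] at hgu; simp at hgu; exact hg hgu
  obtain ⟨v, hv, hvn⟩ := Polynomial.exists_eq_pow_rootMultiplicity_mul_and_not_dvd u hu (b ^ p)
  set s := u.rootMultiplicity (b ^ p) with hsdef
  obtain ⟨w, hw⟩ : (Polynomial.X - Polynomial.C b) ∣ (Polynomial.X ^ p - Polynomial.C (b ^ p)) := by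
    rw [Polynomial.dvd_iff_isRoot]; simp
  have hwb : w.eval b ≠ 0 := by
    have := congrArg (fun q => (Polynomial.derivative q).eval b) hw
    simp [-map_pow] at this
    rw [← this, Polynomial.derivative_X_pow, Polynomial.eval_mul, Polynomial.eval_C, Polynomial.eval_pow,
      Polynomial.eval_X]
    exact mul_ne_zero (Nat.cast_ne_zero.mpr hp.ne') (pow_ne_zero _ hb)
  have hvb : v.eval (b ^ p) ≠ 0 := by
    intro h; exact hvn (Polynomial.dvd_iff_isRoot.mpr h)
  have hge : g = (Polynomial.X - Polynomial.C b) ^ s *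
      (Polynomial.X ^ r * (w ^ s * Polynomial.expand k p v)) := by
    rw [hgu, hv, map_mul, map_pow]
    have : (Polynomial.expand k p) (Polynomial.X - Polynomial.C (b ^ p)) =
      Polynomial.X ^ p - Polynomial.C (b ^ p) := by rw [map_sub, Polynomial.expand_X, Polynomial.expand_C]
    rw [this, hw, mul_pow]; ring
  have hrm : g.rootMultiplicity b ≤ s := by
    by_contra hlt
    push Not at hlt
    have h1 : (Polynomial.X - Polynomial.C b) ^ (s + 1) ∣ g :=
      (pow_dvd_pow _ hlt).trans (Polynomial.pow_rootMultiplicity_dvd g b)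
    rw [pow_succ] at h1
    conv at h1 => rhs; rw [hge]
    have h2 := (mul_dvd_mul_iff_left (pow_ne_zero s (Polynomial.X_sub_C_ne_zero b))).mp h1
    rw [Polynomial.dvd_iff_isRoot] at h2
    simp [Polynomial.IsRoot, Polynomial.expand_eval, hb, hwb, hvb] at h2
  have hdu : s ≤ u.natDegree := by
    have := Polynomial.natDegree_le_of_dvd (Polynomial.pow_rootMultiplicity_dvd u (b ^ p)) hu
    rwa [Polynomial.natDegree_pow, Polynomial.natDegree_X_sub_C, mul_one] at this
  have hdg : p * u.natDegree ≤ g.natDegree := by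
    conv_rhs => rw [hgu]
    rw [Polynomial.natDegree_mul (by simp) (by rw [Ne, Polynomial.expand_eq_zero hp]; exact hu), Polynomial.natDegree_expand]
    rw [mul_comm]; omega
  calc _ ≤ p * u.natDegree := Nat.mul_le_mul_left _ (hrm.trans hdu)
    _ ≤ _ := hdg

end Mult

section Jung

theorem wt_one (s : Fin 2 →₀ ℕ) : wt 1 1 s = s.sum fun _ e => e := by
  rw [Finsupp.sum_fintype _ _ (by simp), Fin.sum_univ_two]; simp [wt]

theorem exists_top (m n : ℕ) (f : RR) (hf : f ≠ 0) :
    ∃ W, (∀ s ∈ f.support, wt m n s ≤ W) ∧ ∃ s ∈ f.support, wt m n s = W := by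
  obtain ⟨s, hs, h⟩ := Finset.exists_max_image f.support (wt m n) (support_nonempty.mpr hf)
  exact ⟨_, h, s, hs, rfl⟩

theorem exists_deg (f : RR) (hf : f ≠ 0) : ∃ s ∈ f.support, wt 1 1 s = f.totalDegree := by
  obtain ⟨s, hs, hmax⟩ := Finset.exists_mem_eq_sup f.support
    (support_nonempty.mpr hf) (fun s => s.sum fun _ e => e)
  exact ⟨s, hs, by rw [wt_one]; exact hmax.symm⟩

theorem le_deg (f : RR) (s) (hs : s ∈ f.support) : wt 1 1 s ≤ f.totalDegree := by
  rw [wt_one]; exact le_totalDegree hs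

theorem line_coeff {S : Type*} [CommRing S] [Algebra k S] (y : S) (u : RR) (N : ℕ)
    (hN : u.totalDegree ≤ N) :
    (aeval ![(Polynomial.X : Polynomial S), Polynomial.C y * Polynomial.X] u).coeff N
      = tf 1 1 N 1 y u := by
  rw [top_coeff 1 1 N _ _ Polynomial.natDegree_X_le ((Polynomial.natDegree_C_mul_le y _).trans Polynomial.natDegree_X_le) u
    (fun s hs => (le_deg u s hs).trans hN)]
  simp

theorem line_degree {S : Type*} [CommRing S] [Algebra k S] (y : S) (u : RR) :
    (aeval ![(Polynomial.X : Polynomial S), Polynomial.C y * Polynomial.X] u).natDegree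
      ≤ u.totalDegree := by
  rw [Polynomial.natDegree_le_iff_coeff_eq_zero]
  intro N hN
  rw [line_coeff y u N hN.le, tf_sum]
  refine Finset.sum_eq_zero fun s hs => if_neg ?_
  have := le_deg u s hs
  omega

theorem sigma_C (σ : AA) (c : k) : σ (C c) = C c := σ.commutes c

theorem sigma_deg_pos (σ : AA) (u : RR) (hu : 0 < u.totalDegree) : 0 < (σ u).totalDegree := by
  by_contra h
  have h0 : (σ u).totalDegree = 0 := by omega
  rw [totalDegree_eq_zero_iff_eq_C] at h0
  have : u = C (coeff 0 (σ u)) := by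
    apply σ.injective
    rw [sigma_C]; exact h0
  rw [this, totalDegree_C] at hu
  omega

theorem sigma_X_pos (σ : AA) (i : Fin 2) : 0 < (σ (X i)).totalDegree :=
  sigma_deg_pos σ _ (by rw [totalDegree_X]; omega)

theorem aeval_sigma {S : Type*} [CommRing S] [Algebra k S] (φ : RR →ₐ[k] S) (σ : AA) (G : RR) :
    φ (σ G) = aeval ![φ (σ (X 0)), φ (σ (X 1))] G := by
  have : (φ.comp (σ : RR →ₐ[k] RR)) = aeval ![φ (σ (X 0)), φ (σ (X 1))] := by
    apply MvPolynomial.algHom_ext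
    intro i; fin_cases i <;> simp
  exact DFunLike.congr_fun this G

theorem tf_iter (m n μ N : ℕ) (a : k) (f : RR) :
    Polynomial.derivative^[μ] (tf m n (N + μ * n) (Polynomial.C a) Polynomial.X f)
      = tf m n N (Polynomial.C a) Polynomial.X ((pderiv 1)^[μ] f) := by
  induction μ generalizing f with
  | zero => simp
  | succ μ ih =>
    have h : N + (μ + 1) * n = (N + μ * n) + n := by ring
    rw [Function.iterate_succ_apply, Function.iterate_succ_apply, ← ih, ← tf_deriv, h]

theorem pderiv_wt (m n μ N : ℕ) (f : RR) (hf : ∀ s ∈ f.support, wt m n s ≤ N + μ * n) :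
    ∀ s ∈ ((pderiv 1)^[μ] f).support, wt m n s ≤ N := by
  induction μ generalizing f with
  | zero => simpa using hf
  | succ μ ih =>
    rw [Function.iterate_succ_apply]
    apply ih
    intro s hs
    rw [mem_support_iff, coeff_pderiv] at hs
    have h := hf (s + Finsupp.single 1 1) (by
      rw [mem_support_iff]; intro h; simp [h] at hs)
    simp [wt, add_mul] at h ⊢
    omega

set_option maxHeartbeats 1000000 in
theorem key [CharZero k] (σ : AA) (G : RR) (W : ℕ)
    (hW : ∀ s ∈ G.support, wt (σ (X 0)).totalDegree (σ (X 1)).totalDegree s ≤ W)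
    (hW' : ∃ s ∈ G.support, wt (σ (X 0)).totalDegree (σ (X 1)).totalDegree s = W) :
    ∃ μ, μ * Nat.lcm (σ (X 0)).totalDegree (σ (X 1)).totalDegree ≤ W ∧
      W + 2 * μ ≤ (σ G).totalDegree + μ * (σ (X 0)).totalDegree + μ * (σ (X 1)).totalDegree := by
  set m := (σ (X 0)).totalDegree with hm
  set n := (σ (X 1)).totalDegree with hn
  have hm0 : 0 < m := sigma_X_pos σ 0
  have hn0 : 0 < n := sigma_X_pos σ 1
  have hA : tf 1 1 m (Polynomial.C (1 : k)) Polynomial.X (σ (X 0)) ≠ 0 := by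
    obtain ⟨s, hs, h⟩ := exists_deg (σ (X 0)) (by intro h; rw [h] at hm; simp at hm; omega)
    exact tf_ne_zero 1 1 m one_pos 1 one_ne_zero _ s hs h
  have hB : tf 1 1 n (Polynomial.C (1 : k)) Polynomial.X (σ (X 1)) ≠ 0 := by
    obtain ⟨s, hs, h⟩ := exists_deg (σ (X 1)) (by intro h; rw [h] at hn; simp at hn; omega)
    exact tf_ne_zero 1 1 n one_pos 1 one_ne_zero _ s hs h
  obtain ⟨β, hβ⟩ : ∃ β : k, Polynomial.eval β (tf 1 1 m (Polynomial.C (1 : k)) Polynomial.X (σ (X 0)) *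
      tf 1 1 n (Polynomial.C (1 : k)) Polynomial.X (σ (X 1))) ≠ 0 := by
    by_contra hcon
    push Not at hcon
    exact mul_ne_zero hA hB (Polynomial.funext (by simpa using hcon))
  rw [Polynomial.eval_mul] at hβ
  let ρ : RR →ₐ[k] Polynomial k := aeval ![Polynomial.X, Polynomial.C β * Polynomial.X]
  have ha : (ρ (σ (X 0))).coeff m ≠ 0 := by
    rw [line_coeff β _ m le_rfl]
    have := aeval_tf 1 1 m 1 β (σ (X 0))
    rw [map_one (algebraMap k k)] at this
    rw [← this]
    exact left_ne_zero_of_mul hβ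
  have hb : (ρ (σ (X 1))).coeff n ≠ 0 := by
    rw [line_coeff β _ n le_rfl]
    have := aeval_tf 1 1 n 1 β (σ (X 1))
    rw [map_one (algebraMap k k)] at this
    rw [← this]
    exact right_ne_zero_of_mul hβ
  set a := (ρ (σ (X 0))).coeff m with hadef
  set b := (ρ (σ (X 1))).coeff n with hbdef
  obtain ⟨s₀, hs₀, hs₀W⟩ := hW'
  set g := tf m n W (Polynomial.C a) Polynomial.X G with hg
  have hg0 : g ≠ 0 := tf_ne_zero m n W hm0 a ha G s₀ hs₀ hs₀W
  set p := m / Nat.gcd m n with hp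
  set q := n / Nat.gcd m n with hq
  have hgcd : 0 < Nat.gcd m n := Nat.gcd_pos_of_pos_left _ hm0
  have hmp : m = Nat.gcd m n * p := (Nat.mul_div_cancel' (Nat.gcd_dvd_left m n)).symm
  have hnq : n = Nat.gcd m n * q := (Nat.mul_div_cancel' (Nat.gcd_dvd_right m n)).symm
  have hp0 : 0 < p := Nat.pos_of_ne_zero (by rintro h; rw [h] at hmp; omega)
  have hcop : Nat.Coprime p q := Nat.coprime_div_gcd_div_gcd hgcd
  have hdeg : g.natDegree * n ≤ W := by
    obtain ⟨s, hs, h1, h2⟩ := tf_supp m n W a G g.natDegree (by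
      rw [← hg]; simpa using hg0)
    rw [← h2, ← h1, wt]; omega
  have hcong : ∀ j ∈ g.support, ∃ i, j = (s₀ 1) % p + p * i := by
    intro j hj
    obtain ⟨s, hs, h1, h2⟩ := tf_supp m n W a G j (Polynomial.mem_support_iff.mp hj)
    have h3 : s 0 * p + j * q = s₀ 0 * p + s₀ 1 * q := by
      have : wt m n s = wt m n s₀ := by rw [h1, hs₀W]
      rw [wt, wt, h2] at this
      apply Nat.eq_of_mul_eq_mul_left hgcd
      have e1 : Nat.gcd m n * (s 0 * p + j * q) = s 0 * (Nat.gcd m n * p) + j * (Nat.gcd m n * q) := by ring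
      have e2 : Nat.gcd m n * (s₀ 0 * p + s₀ 1 * q) = s₀ 0 * (Nat.gcd m n * p) + s₀ 1 * (Nat.gcd m n * q) := by ring
      rw [e1, e2, ← hmp, ← hnq, this]
    have h4 : j * q ≡ s₀ 1 * q [MOD p] := by
      have : (s 0 * p + j * q) % p = (s₀ 0 * p + s₀ 1 * q) % p := by rw [h3]
      rwa [Nat.add_comm, Nat.add_mul_mod_self_right, Nat.add_comm (s₀ 0 * p), Nat.add_mul_mod_self_right] at this
    have h5 : j ≡ s₀ 1 [MOD p] := Nat.ModEq.cancel_right_of_coprime hcop h4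
    refine ⟨j / p, ?_⟩
    rw [← h5]
    exact (Nat.mod_add_div j p).symm
  set μ := g.rootMultiplicity b with hμ
  have hmb : p * μ ≤ g.natDegree := mult_bound p _ hp0 g hg0 hcong b hb
  have hlcm : Nat.lcm m n = p * n := by
    rw [Nat.lcm, hp, Nat.div_mul_right_comm (Nat.gcd_dvd_left m n)]
  have h1 : μ * Nat.lcm m n ≤ W := by
    rw [hlcm]
    calc μ * (p * n) = (p * μ) * n := by ring
      _ ≤ g.natDegree * n := Nat.mul_le_mul_right _ hmb
      _ ≤ W := hdeg
  have hμn : μ * n ≤ W := by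
    refine le_trans ?_ h1
    rw [hlcm]
    exact Nat.mul_le_mul_left _ (Nat.le_mul_of_pos_left _ hp0)
  obtain ⟨N, hN⟩ := Nat.exists_eq_add_of_le' hμn
  refine ⟨μ, h1, ?_⟩
  have hev : (Polynomial.derivative^[μ] g).eval b ≠ 0 := by
    rw [hμ, Polynomial.eval_iterate_derivative_rootMultiplicity]
    rw [nsmul_eq_mul]
    refine mul_ne_zero (Nat.cast_ne_zero.mpr (Nat.factorial_ne_zero _)) ?_
    exact Polynomial.eval_divByMonic_pow_rootMultiplicity_ne_zero b hg0
  set H := (pderiv 1)^[μ] G with hH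
  have hco : (ρ (σ H)).coeff N ≠ 0 := by
    rw [aeval_sigma ρ σ H, top_coeff m n N _ _ (line_degree β _) (line_degree β _) H
      (pderiv_wt m n μ N G (by rw [← hN]; exact hW))]
    have := aeval_tf m n N a b H
    rw [← hadef, ← hbdef, ← Algebra.algebraMap_self_apply a, ← this, hH, ← tf_iter, ← hN, ← hg]
    exact hev
  have hH0 : H ≠ 0 := by
    rintro h; rw [h] at hco; simp at hco
  have h2 : N ≤ (σ H).totalDegree := by
    by_contra hlt
    exact hco (Polynomial.coeff_eq_zero_of_natDegree_lt
      (lt_of_le_of_lt (line_degree β _) (not_le.mp hlt)))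
  have h3 := parachute_iter σ μ G hH0
  rw [← hH, ← hm] at h3
  omega

end Jung

section Jung2

theorem deg_div [CharZero k] (σ : AA) :
    (σ (X 0)).totalDegree ∣ (σ (X 1)).totalDegree ∨ (σ (X 1)).totalDegree ∣ (σ (X 0)).totalDegree := by
  by_contra hcon
  push Not at hcon
  obtain ⟨h1, h2⟩ := hcon
  obtain ⟨W, hW, hW'⟩ := exists_top (σ (X 0)).totalDegree (σ (X 1)).totalDegree (σ.symm (X 0))
    (by simp)
  obtain ⟨μ, hμ1, hμ2⟩ := key σ _ W hW hW'
  rw [AlgEquiv.apply_symm_apply, totalDegree_X] at hμ2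
  set m := (σ (X 0)).totalDegree with hm
  set n := (σ (X 1)).totalDegree with hn
  have hm0 : 0 < m := sigma_X_pos σ 0
  have hn0 : 0 < n := sigma_X_pos σ 1
  have hm1 : m ≠ 1 := by rintro h; exact h1 (h ▸ one_dvd _)
  have hn1 : n ≠ 1 := by rintro h; exact h2 (h ▸ one_dvd _)
  have hW2 : 2 ≤ W := by
    obtain ⟨s, hs, h⟩ := exists_deg (σ.symm (X 0)) (by simp)
    have h3 := sigma_X_pos σ.symm 0
    have h4 := hW s hs
    rw [← h] at h3
    simp only [wt, mul_one] at h3 h4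
    rcases Nat.eq_zero_or_pos (s 0) with h5 | h5
    · have : n ≤ s 1 * n := Nat.le_mul_of_pos_left _ (by omega)
      omega
    · have : m ≤ s 0 * m := Nat.le_mul_of_pos_left _ h5
      omega
  set g := Nat.gcd m n
  have hg : 0 < g := Nat.gcd_pos_of_pos_left _ hm0
  obtain ⟨p, hp⟩ : g ∣ m := Nat.gcd_dvd_left m n
  obtain ⟨q, hq⟩ : g ∣ n := Nat.gcd_dvd_right m n
  have hp2 : 2 ≤ p := by
    rcases p with _ | _ | p
    · omega
    · exfalso; apply h1; rw [hp, hq]; simp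
    · omega
  have hq2 : 2 ≤ q := by
    rcases q with _ | _ | q
    · omega
    · exfalso; apply h2; rw [hp, hq]; simp
    · omega
  have hl : Nat.lcm m n = g * (p * q) := by
    have h5 := Nat.gcd_mul_lcm m n
    apply Nat.eq_of_mul_eq_mul_left hg
    have h6 : g * Nat.lcm m n = m * n := h5
    rw [h6]
    conv_lhs => rw [hp, hq]
    ring
  have hne : p ≠ q := by
    rintro rfl; apply h1; rw [hp, hq]
  have hpq : p + q ≤ p * q := by
    obtain ⟨a, rfl⟩ := Nat.exists_eq_add_of_le hp2
    obtain ⟨b, rfl⟩ := Nat.exists_eq_add_of_le hq2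
    nlinarith [Nat.zero_le (a * b)]
  have h7 : m + n ≤ Nat.lcm m n := by
    rw [hl]
    calc m + n = g * (p + q) := by rw [mul_add, ← hp, ← hq]
      _ ≤ _ := Nat.mul_le_mul_left _ hpq
  have h8 : μ * (m + n) ≤ W := (Nat.mul_le_mul_left _ h7).trans hμ1
  rw [mul_add] at h8
  rcases Nat.eq_zero_or_pos μ with h9 | h9
  · rw [h9] at hμ2; omega
  · omega

theorem exists_big (σ : AA) (hn : 2 ≤ (σ (X 1)).totalDegree) :
    ∃ G : RR, (σ G).totalDegree = 1 ∧
      ∃ s ∈ G.support, 2 ≤ wt (σ (X 0)).totalDegree (σ (X 1)).totalDegree s := by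
  by_contra hcon
  push Not at hcon
  have h : ∀ i : Fin 2, pderiv 1 (σ.symm (X i)) = 0 := by
    intro i
    have h1 := hcon (σ.symm (X i)) (by simp)
    ext s
    rw [coeff_pderiv, coeff_zero]
    by_contra h2
    have h3 := h1 (s + Finsupp.single 1 1) (by
      rw [mem_support_iff]; intro h; simp [h] at h2)
    simp [wt, add_mul] at h3
    omega
  have h2 := (jac_unit σ.symm).ne_zero
  apply h2
  simp [jac, h]

theorem alg_mem {K : Type*} [Field K] [Algebra k K] [IsAlgClosed k] (z : K) (h : Polynomial k)
    (hh : h ≠ 0) (hz : Polynomial.aeval z h = 0) : ∃ c : k, algebraMap k K c = z := by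
  have : IsAlgebraic k z := ⟨h, hh, hz⟩
  have h1 := IsAlgClosed.degree_eq_one_of_irreducible k (minpoly.irreducible this.isIntegral)
  exact minpoly.mem_range_of_degree_eq_one k z h1

theorem pow_rel [IsAlgClosed k] (σ : AA) (e : ℕ)
    (hn : 2 ≤ (σ (X 1)).totalDegree) (he : (σ (X 1)).totalDegree = (σ (X 0)).totalDegree * e) :
    ∃ c : k, (σ (X 1) - C c * (σ (X 0)) ^ e).totalDegree < (σ (X 1)).totalDegree := by
  obtain ⟨G, hG1, s₁, hs₁, hs₁W⟩ := exists_big σ hn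
  have hG0 : G ≠ 0 := by rintro rfl; simp at hG1
  obtain ⟨W, hW, s₀, hs₀, hs₀W⟩ := exists_top (σ (X 0)).totalDegree (σ (X 1)).totalDegree G hG0
  have hW2 : 2 ≤ W := hs₁W.trans (hW s₁ hs₁)
  set m := (σ (X 0)).totalDegree with hm
  set n := (σ (X 1)).totalDegree with hn'
  have hm0 : 0 < m := sigma_X_pos σ 0
  let ρ : RR →ₐ[k] Polynomial (Polynomial k) :=
    aeval ![Polynomial.X, Polynomial.C Polynomial.X * Polynomial.X]
  have hρ : ∀ u : RR, (ρ u).natDegree ≤ u.totalDegree := line_degree _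
  have hρc : ∀ (u : RR) (N : ℕ), u.totalDegree ≤ N →
      (ρ u).coeff N = tf 1 1 N (Polynomial.C (1 : k)) Polynomial.X u := by
    intro u N h; exact line_coeff _ u N h
  set A := (ρ (σ (X 0))).coeff m with hA
  set B := (ρ (σ (X 1))).coeff n with hB
  have hA0 : A ≠ 0 := by
    rw [hA, hρc _ _ le_rfl]
    obtain ⟨s, hs, h⟩ := exists_deg (σ (X 0)) (by simp)
    exact tf_ne_zero 1 1 m one_pos 1 one_ne_zero _ s hs h
  have hz : tf m n W A B G = 0 := by
    rw [hA, hB, ← top_coeff m n W _ _ (hρ _) (hρ _) G hW, ← aeval_sigma ρ σ G]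
    apply Polynomial.coeff_eq_zero_of_natDegree_lt
    have := hρ (σ G)
    omega
  let K := FractionRing (Polynomial k)
  let ι := algebraMap (Polynomial k) K
  have hι : Function.Injective ι := IsFractionRing.injective (Polynomial k) K
  have hιA : ι A ≠ 0 := by rw [Ne, map_eq_zero_iff ι hι]; exact hA0
  set z : K := ι B / (ι A) ^ e with hzdef
  obtain ⟨c, hc⟩ := alg_mem z (tf m n W (Polynomial.C 1) Polynomial.X G)
    (tf_ne_zero m n W hm0 1 one_ne_zero G s₀ hs₀ hs₀W) (by
      rw [aeval_tf]
      have h1 : (ι A) ^ (s₀ 0 + e * s₀ 1) * tf m n W (algebraMap k K 1) z G = ι (tf m n W A B G) := by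
        rw [tf_sum, tf_sum, Finset.mul_sum, map_sum]
        refine Finset.sum_congr rfl fun s hs => ?_
        split_ifs with h
        · have h2 : s₀ 0 + e * s₀ 1 = s 0 + e * s 1 := by
            have h3 : wt m n s₀ = wt m n s := by rw [h, hs₀W]
            rw [wt, wt, he] at h3
            apply Nat.eq_of_mul_eq_mul_left hm0
            linarith [h3]
          have h4 : ι B = z * (ι A) ^ e := by rw [hzdef]; exact (div_mul_cancel₀ _ (pow_ne_zero _ hιA)).symm
          rw [h2, map_mul, map_mul, map_pow, map_pow, h4, map_one (algebraMap k K), one_pow, one_mul]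
          have h5 : ι (algebraMap k (Polynomial k) (coeff s G)) = algebraMap k K (coeff s G) :=
            (IsScalarTower.algebraMap_apply k (Polynomial k) K _).symm
          rw [h5]; ring
        · simp
      rw [hz, map_zero ι] at h1
      exact (mul_eq_zero.mp h1).resolve_left (pow_ne_zero _ hιA))
  have hBA : B = Polynomial.C c * A ^ e := by
    apply hι
    have h4 : ι B = z * (ι A) ^ e := by rw [hzdef]; exact (div_mul_cancel₀ _ (pow_ne_zero _ hιA)).symm
    have h5 : ι (Polynomial.C c) = algebraMap k K c :=
            (IsScalarTower.algebraMap_apply k (Polynomial k) K _).symm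
    rw [h4, map_mul, map_pow, h5, hc]
  refine ⟨c, ?_⟩
  have hPe : ((σ (X 0)) ^ e).totalDegree ≤ n := by
    have := totalDegree_pow (σ (X 0)) e
    rw [he]; rw [mul_comm] at this; exact this
  have hle : (σ (X 1) - C c * (σ (X 0)) ^ e).totalDegree ≤ n := by
    refine (totalDegree_sub _ _).trans (max_le le_rfl ?_)
    refine (totalDegree_mul _ _).trans ?_
    rw [totalDegree_C]; omega
  refine lt_of_le_of_ne hle ?_
  intro heq
  have hne : (σ (X 1) - C c * (σ (X 0)) ^ e) ≠ 0 := by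
    intro h; rw [h] at heq; simp at heq; omega
  obtain ⟨s, hs, h⟩ := exists_deg _ hne
  apply tf_ne_zero 1 1 n one_pos (1 : k) one_ne_zero _ s hs (h.trans heq)
  rw [← hρc _ n hle, map_sub, map_mul, map_pow, Polynomial.coeff_sub, ← hB, hBA]
  have h6 : ρ (C c) = Polynomial.C (Polynomial.C c) := by
    simp [ρ, algHom_C, Polynomial.algebraMap_apply]
  rw [h6, Polynomial.coeff_C_mul, he, mul_comm m e, Polynomial.coeff_pow_of_natDegree_le (hρ _), sub_self]

theorem totalDegree_pow_eq (u : RR) (n : ℕ) : (u ^ n).totalDegree = n * u.totalDegree := by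
  by_cases hu : u = 0
  · rcases n with _ | n <;> simp [hu]
  induction n with
  | zero => simp
  | succ n ih =>
    rw [pow_succ, totalDegree_mul_of_isDomain (pow_ne_zero _ hu) hu, ih]; ring

theorem totalDegree_aeval_eq (u : RR) (hu : 0 < u.totalDegree) (p : Polynomial k) :
    (Polynomial.aeval u p).totalDegree = p.natDegree * u.totalDegree := by
  have hu0 : u ≠ 0 := by rintro rfl; simp at hu
  induction h : p.natDegree using Nat.strong_induction_on generalizing p with
  | _ n ih =>
    rcases Nat.eq_zero_or_pos n with h0 | h0
    · subst h0
      rw [Polynomial.eq_C_of_natDegree_eq_zero h, Polynomial.aeval_C]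
      rw [zero_mul]; exact totalDegree_C _
    · have hp0 : p ≠ 0 := by rintro rfl; simp at h; omega
      rw [← p.eraseLead_add_C_mul_X_pow, map_add]
      have h1 : (Polynomial.aeval u (Polynomial.C p.leadingCoeff * Polynomial.X ^ p.natDegree)).totalDegree
          = n * u.totalDegree := by
        rw [map_mul, map_pow, Polynomial.aeval_C, Polynomial.aeval_X, h]
        have h2 : algebraMap k RR p.leadingCoeff = C p.leadingCoeff := rfl
        rw [h2, totalDegree_mul_of_isDomain (by simpa using hp0) (pow_ne_zero _ hu0),
          totalDegree_pow_eq, totalDegree_C, zero_add]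
      have h3 : p.eraseLead.natDegree < n := by
        have := p.eraseLead_natDegree_le
        omega
      have h4 := ih _ h3 p.eraseLead rfl
      rw [totalDegree_add_eq_right_of_totalDegree_lt, h1]
      rw [h1, h4]
      exact Nat.mul_lt_mul_of_pos_right h3 hu

/-- elementary automorphism -/
noncomputable def el (p : Polynomial k) : AA :=
  AlgEquiv.ofAlgHom (aeval ![X 0, X 1 + Polynomial.aeval (X 0) p])
    (aeval ![X 0, X 1 - Polynomial.aeval (X 0) p])
    (by
      apply MvPolynomial.algHom_ext
      intro i; fin_cases i <;> simp [← Polynomial.aeval_algHom_apply])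
    (by
      apply MvPolynomial.algHom_ext
      intro i; fin_cases i <;> simp [← Polynomial.aeval_algHom_apply])

theorem el_X0 (p : Polynomial k) : el p (X 0) = X 0 := by simp [el]
theorem el_X1 (p : Polynomial k) : el p (X 1) = X 1 + Polynomial.aeval (X 0) p := by simp [el]

theorem aut_ext (σ τ : AA) (h0 : σ (X 0) = τ (X 0)) (h1 : σ (X 1) = τ (X 1)) : σ = τ := by
  have : (σ : RR →ₐ[k] RR) = τ := by
    apply MvPolynomial.algHom_ext
    intro i; fin_cases i <;> simpa
  ext1 u
  exact DFunLike.congr_fun this u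

theorem el_mul_neg (p : Polynomial k) : el p * el (-p) = 1 := by
  apply aut_ext
  · simp [AlgEquiv.mul_apply, el_X0]
  · simp [AlgEquiv.mul_apply, el_X0, el_X1, ← Polynomial.aeval_algHom_apply]

theorem sigma_aeval (σ : AA) (u : RR) (p : Polynomial k) :
    σ (Polynomial.aeval u p) = Polynomial.aeval (σ u) p :=
  (Polynomial.aeval_algHom_apply (σ : RR →ₐ[k] RR) u p).symm

theorem mul_el_X0 (σ : AA) (p : Polynomial k) : (σ * el p) (X 0) = σ (X 0) := by
  simp [AlgEquiv.mul_apply, el_X0]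

theorem mul_el_X1 (σ : AA) (p : Polynomial k) :
    (σ * el p) (X 1) = σ (X 1) + Polynomial.aeval (σ (X 0)) p := by
  rw [AlgEquiv.mul_apply, el_X1, map_add, sigma_aeval]

theorem red [CharZero k] [IsAlgClosed k] (σ : AA)
    (h : (σ (X 0)).totalDegree < (σ (X 1)).totalDegree) :
    ∃ p : Polynomial k, 2 ≤ p.natDegree ∧ p.natDegree ≤ (σ (X 1)).totalDegree ∧
      (((σ * el (-p)) (X 1)).totalDegree < (σ (X 0)).totalDegree ∨
        (σ (X 0)).totalDegree = 1 ∧ ((σ * el (-p)) (X 1)).totalDegree = 1) := by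
  classical
  obtain ⟨p, hp⟩ : ∃ p : Polynomial k, ∀ q : Polynomial k,
      ((σ * el (-p)) (X 1)).totalDegree ≤ ((σ * el (-q)) (X 1)).totalDegree := by
    let S : Set ℕ := Set.range fun p : Polynomial k => ((σ * el (-p)) (X 1)).totalDegree
    have hS : S.Nonempty := ⟨_, 0, rfl⟩
    obtain ⟨p, hp⟩ := WellFounded.min_mem Nat.lt_wfRel.wf S hS
    exact ⟨p, fun q => hp.le.trans (not_lt.mp (WellFounded.not_lt_min Nat.lt_wfRel.wf S ⟨q, rfl⟩))⟩
  have hm0 := sigma_X_pos σ 0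
  have hdisj : (((σ * el (-p)) (X 1)).totalDegree < (σ (X 0)).totalDegree ∨
        (σ (X 0)).totalDegree = 1 ∧ ((σ * el (-p)) (X 1)).totalDegree = 1) := by
    by_contra hcon
    push Not at hcon
    obtain ⟨h1, h2⟩ := hcon
    set τ := σ * el (-p) with hτ
    have hτ0 : τ (X 0) = σ (X 0) := mul_el_X0 σ _
    rw [← hτ0] at h1 h2 hm0
    have hdvd : (τ (X 0)).totalDegree ∣ (τ (X 1)).totalDegree := by
      rcases deg_div τ with h3 | h3
      · exact h3
      · have := Nat.le_of_dvd hm0 h3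
        have : (τ (X 0)).totalDegree = (τ (X 1)).totalDegree := by omega
        rw [this]
    obtain ⟨e, he⟩ := hdvd
    have h2' : 2 ≤ (τ (X 1)).totalDegree := by
      by_contra h4
      exact h2 (by omega) (by omega)
    obtain ⟨c, hc⟩ := pow_rel τ e h2' he
    have h5 := hp (p + Polynomial.C c * Polynomial.X ^ e)
    have h6 : ((σ * el (-(p + Polynomial.C c * Polynomial.X ^ e)) : AA) (X 1 : RR)) =
        τ (X 1) - C c * τ (X 0) ^ e := by
      rw [hτ0, hτ, mul_el_X1, mul_el_X1]
      simp only [map_neg, map_add, map_mul, map_pow, Polynomial.aeval_C, Polynomial.aeval_X]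
      have : algebraMap k RR c = C c := rfl
      rw [this]; ring
    rw [h6] at h5
    omega
  have hQ : σ (X 1) = (σ * el (-p)) (X 1) + Polynomial.aeval (σ (X 0)) p := by
    rw [mul_el_X1, map_neg]; ring
  have hlt : ((σ * el (-p)) (X 1)).totalDegree < (σ (X 1)).totalDegree := by
    rcases hdisj with h1 | h1 <;> omega
  have hdeg := totalDegree_aeval_eq (σ (X 0)) hm0 p
  have heq : (Polynomial.aeval (σ (X 0)) p).totalDegree = (σ (X 1)).totalDegree := by
    have h1 : Polynomial.aeval (σ (X 0)) p = σ (X 1) - (σ * el (-p)) (X 1) := by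
      rw [mul_el_X1, map_neg]; ring
    rw [h1, sub_eq_add_neg]
    apply totalDegree_add_eq_left_of_totalDegree_lt
    rwa [totalDegree_neg]
  refine ⟨p, ?_, ?_, hdisj⟩
  · by_contra h1
    have : p.natDegree * (σ (X 0)).totalDegree ≤ 1 * (σ (X 0)).totalDegree :=
      Nat.mul_le_mul_right _ (by omega)
    omega
  · rw [← heq, hdeg]
    exact Nat.le_mul_of_pos_right _ hm0

end Jung2


section LemL

theorem shift_top (f : RR) (p : Polynomial k) (D : ℕ)
    (hD : ∀ s ∈ f.support, wt 1 p.natDegree s ≤ D) :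
    tf 1 p.natDegree D (Polynomial.C (1 : k)) Polynomial.X (el p f) =
      (tf 1 p.natDegree D (Polynomial.C (1 : k)) Polynomial.X f).comp
        (Polynomial.X + Polynomial.C p.leadingCoeff) := by
  set n := p.natDegree with hn
  let ρ : RR →ₐ[k] Polynomial (Polynomial k) :=
    aeval ![Polynomial.X, Polynomial.C Polynomial.X * Polynomial.X ^ n]
  have hXd : (Polynomial.X : Polynomial (Polynomial k)).natDegree ≤ 1 := Polynomial.natDegree_X_le
  have hCd : (Polynomial.C Polynomial.X * Polynomial.X ^ n : Polynomial (Polynomial k)).natDegree ≤ n :=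
    Polynomial.natDegree_C_mul_X_pow_le _ _
  have hpd : (p.map (algebraMap k (Polynomial k))).natDegree ≤ n := Polynomial.natDegree_map_le
  have hsum : (Polynomial.C Polynomial.X * Polynomial.X ^ n + p.map (algebraMap k (Polynomial k))
      : Polynomial (Polynomial k)).natDegree ≤ n := Polynomial.natDegree_add_le_of_degree_le hCd hpd
  have h1 : ρ (el p f) = aeval ![Polynomial.X,
      Polynomial.C Polynomial.X * Polynomial.X ^ n + p.map (algebraMap k (Polynomial k))] f := by
    rw [aeval_sigma ρ (el p) f, el_X0, el_X1, map_add, ← Polynomial.aeval_algHom_apply]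
    have e0 : ρ (X 0) = Polynomial.X := by simp [ρ]
    have e1 : ρ (X 1) = Polynomial.C Polynomial.X * Polynomial.X ^ n := by simp [ρ]
    rw [e0, e1, Polynomial.aeval_X_left_eq_map]
  have hc : (Polynomial.C Polynomial.X * Polynomial.X ^ n + p.map (algebraMap k (Polynomial k))
      : Polynomial (Polynomial k)).coeff n = Polynomial.X + Polynomial.C p.leadingCoeff := by
    rw [Polynomial.coeff_add, Polynomial.coeff_C_mul_X_pow, Polynomial.coeff_map]
    simp [hn]
  have h2 : ∀ N, D ≤ N → (ρ (el p f)).coeff N = tf 1 n N 1 (Polynomial.X + Polynomial.C p.leadingCoeff) f := by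
    intro N hN
    rw [h1, top_coeff 1 n N _ _ hXd hsum f (fun s hs => (hD s hs).trans hN), hc, Polynomial.coeff_X_one]
  have h3 : ∀ N, (∀ s ∈ (el p f).support, wt 1 n s ≤ N) →
      (ρ (el p f)).coeff N = tf 1 n N 1 Polynomial.X (el p f) := by
    intro N hN
    have := top_coeff 1 n N _ _ hXd hCd (el p f) hN
    rw [Polynomial.coeff_X_one, Polynomial.coeff_C_mul_X_pow] at this
    simpa using this
  have h4 : ∀ s ∈ (el p f).support, wt 1 n s ≤ D := by
    by_cases hf : f = 0
    · subst hf; simp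
    obtain ⟨D', hD', s', hs', hsD'⟩ := exists_top 1 n (el p f) (by simpa using hf)
    intro s hs
    refine (hD' s hs).trans ?_
    by_contra hcon
    push Not at hcon
    have h5 := h2 D' hcon.le
    rw [h3 D' hD', tf_sum 1 n D' 1 (Polynomial.X + _) f] at h5
    refine tf_ne_zero 1 n D' one_pos (1 : k) one_ne_zero (el p f) s' hs' hsD' ?_
    rw [Polynomial.C_1, h5]
    refine Finset.sum_eq_zero fun t ht => if_neg ?_
    have := hD t ht
    omega
  rw [Polynomial.C_1, ← h3 D h4, h2 D le_rfl]
  have := aeval_tf (S := Polynomial k) 1 n D (1 : k) (Polynomial.X + Polynomial.C p.leadingCoeff) f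
  rw [Polynomial.C_1, map_one] at this
  rw [← this, Polynomial.comp, Polynomial.aeval_def]
  rfl

theorem lemL_arith (n D x0 x1 a0 a1 b0 b1 c0 c1 : ℕ) (hn : 2 ≤ n)
    (w1 : a0 + a1 * n = D) (w2 : b0 + b1 * n = D) (w3 : c0 + c1 * n = D)
    (i1 : a0 + a1 ≤ x0 + x1) (i2 : b0 + b1 ≤ x0 + x1) (i4 : x0 + x1 * n ≤ D)
    (h : a1 + b1 ≤ c1) : 3 * x1 ≤ x0 + x1 := by
  obtain ⟨n', rfl⟩ : ∃ n', n = n' + 2 := ⟨n - 2, by omega⟩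
  have j1 : x1 ≤ a1 := by
    by_contra hcon
    push Not at hcon
    nlinarith
  have j2 : x1 ≤ b1 := by
    by_contra hcon
    push Not at hcon
    nlinarith
  have j3 : (a1 + b1) * (n' + 2) ≤ c1 * (n' + 2) := Nat.mul_le_mul_right _ h
  have j4 : 0 ≤ a1 * n' := Nat.zero_le _
  nlinarith

theorem lemL (f : RR) (p : Polynomial k) (hn : 2 ≤ p.natDegree)
    (hd : (el p f).totalDegree ≤ f.totalDegree) (s : Fin 2 →₀ ℕ) (hs : s ∈ f.support)
    (hsd : wt 1 1 s = f.totalDegree) : 3 * s 1 ≤ f.totalDegree := by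
  have hf : f ≠ 0 := by rintro rfl; simp at hs
  obtain ⟨D, hD, s₀, hs₀, hs₀D⟩ := exists_top 1 p.natDegree f hf
  have hsh := shift_top f p D hD
  have hg0 := tf_ne_zero 1 p.natDegree D one_pos (1 : k) one_ne_zero f s₀ hs₀ hs₀D
  set g := tf 1 p.natDegree D (Polynomial.C (1 : k)) Polynomial.X f with hg
  have ha : p.leadingCoeff ≠ 0 := by
    rw [Ne, Polynomial.leadingCoeff_eq_zero]; rintro rfl; simp at hn
  set a := p.leadingCoeff with ha'
  set n := p.natDegree with hn'
  set G := g.comp (Polynomial.X + Polynomial.C a) with hG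
  have hback : G.comp (Polynomial.X - Polynomial.C a) = g := by
    rw [hG, Polynomial.comp_assoc]; simp
  have hG0 : G ≠ 0 := by
    intro h; rw [h] at hback; simp at hback; exact hg0 hback.symm
  have hμ : g.coeff g.natTrailingDegree ≠ 0 := by
    have := Polynomial.trailingCoeff_nonzero_iff_nonzero.mpr hg0; exact this
  have hm : G.coeff G.natTrailingDegree ≠ 0 := by
    have := Polynomial.trailingCoeff_nonzero_iff_nonzero.mpr hG0; exact this
  have ht : g.coeff g.natDegree ≠ 0 := by
    have := Polynomial.leadingCoeff_ne_zero.mpr hg0; exact this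
  have hsumle : g.natTrailingDegree + G.natTrailingDegree ≤ g.natDegree := by
    have d1 : Polynomial.X ^ g.natTrailingDegree ∣ g := by
      rw [Polynomial.X_pow_dvd_iff]
      intro d hd; exact Polynomial.coeff_eq_zero_of_lt_natTrailingDegree hd
    have d2 : Polynomial.X ^ G.natTrailingDegree ∣ G := by
      rw [Polynomial.X_pow_dvd_iff]
      intro d hd; exact Polynomial.coeff_eq_zero_of_lt_natTrailingDegree hd
    have d3 : (Polynomial.X - Polynomial.C a) ^ G.natTrailingDegree ∣ g := by
      obtain ⟨c, hc⟩ := d2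
      refine ⟨c.comp (Polynomial.X - Polynomial.C a), ?_⟩
      conv_lhs => rw [← hback, hc]
      simp
    have hcop : IsCoprime (Polynomial.X : Polynomial k) (Polynomial.X - Polynomial.C a) := by
      have := Polynomial.isCoprime_X_sub_C_of_isUnit_sub (a := (0 : k)) (b := a) (by simpa using ha)
      simpa using this
    have d4 := (hcop.pow (m := g.natTrailingDegree) (n := G.natTrailingDegree)).mul_dvd d1 d3
    have d5 := Polynomial.natDegree_le_of_dvd d4 hg0
    rwa [Polynomial.natDegree_mul (pow_ne_zero _ Polynomial.X_ne_zero)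
      (pow_ne_zero _ (Polynomial.X_sub_C_ne_zero a)), Polynomial.natDegree_X_pow,
      Polynomial.natDegree_pow, Polynomial.natDegree_X_sub_C, mul_one] at d5
  obtain ⟨s1, hs1, w1, e1⟩ := tf_supp 1 n D 1 f _ hμ
  obtain ⟨s2, hs2, w2, e2⟩ := tf_supp 1 n D 1 (el p f) G.natTrailingDegree (by rw [hsh]; exact hm)
  obtain ⟨s3, hs3, w3, e3⟩ := tf_supp 1 n D 1 f _ ht
  have i1 := le_deg f s1 hs1
  have i2 := (le_deg _ s2 hs2).trans hd
  have i4 := hD s hs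
  simp only [wt, mul_one] at *
  rw [← hsd] at *
  rw [← e1, ← e2, ← e3] at hsumle
  exact lemL_arith _ _ _ _ _ _ _ _ _ _ hn w1 w2 w3 i1 i2 i4 hsumle

end LemL


section ClaimC

theorem aff_le (σ : AA) (M : ℕ) (h0 : (σ (X 0)).totalDegree ≤ M) (h1 : (σ (X 1)).totalDegree ≤ M)
    (u : RR) : (σ u).totalDegree ≤ M * u.totalDegree := by
  have h : σ u = aeval ![σ (X 0), σ (X 1)] u := aeval_sigma (AlgHom.id k RR) σ u
  rw [h, aeval_def, eval₂_eq']
  apply totalDegree_finsetSum_le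
  intro s hs
  rw [Fin.prod_univ_two]
  have hs' := le_deg u s hs
  have e : algebraMap k RR (coeff s u) = C (coeff s u) := rfl
  rw [e]
  refine (totalDegree_mul _ _).trans ?_
  rw [totalDegree_C, zero_add]
  refine (totalDegree_mul _ _).trans ?_
  rw [totalDegree_pow_eq, totalDegree_pow_eq]
  simp only [Matrix.cons_val_zero, Matrix.cons_val_one]
  simp only [wt, mul_one] at hs'
  calc _ ≤ s 0 * M + s 1 * M := by gcongr
    _ = M * (s 0 + s 1) := by ring
    _ ≤ _ := by gcongr

theorem aff_deg [CharZero k] (σ : AA) (h : IsAff σ) (u : RR) :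
    (σ u).totalDegree = u.totalDegree := by
  apply le_antisymm
  · simpa using aff_le σ 1 h.1.le h.2.le u
  · by_cases hu : u = 0
    · simp [hu]
    obtain ⟨W, hW, s, hs, hsW⟩ := exists_top (σ (X 0)).totalDegree (σ (X 1)).totalDegree u hu
    obtain ⟨μ, hμ1, hμ2⟩ := key σ u W hW ⟨s, hs, hsW⟩
    rw [h.1, h.2] at hW hμ2
    obtain ⟨t, ht, htd⟩ := exists_deg u hu
    have := hW t ht
    omega

theorem aff_inv [CharZero k] (σ : AA) (h : IsAff σ) : IsAff σ⁻¹ := by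
  constructor
  · rw [← aff_deg σ h, ← AlgEquiv.mul_apply, mul_inv_cancel, AlgEquiv.one_apply, totalDegree_X]
  · rw [← aff_deg σ h, ← AlgEquiv.mul_apply, mul_inv_cancel, AlgEquiv.one_apply, totalDegree_X]

theorem aff_mul [CharZero k] (σ τ : AA) (h : IsAff σ) (h' : IsAff τ) : IsAff (σ * τ) :=
  ⟨by rw [AlgEquiv.mul_apply, aff_deg σ h, h'.1], by rw [AlgEquiv.mul_apply, aff_deg σ h, h'.2]⟩

/-- the coordinate swap -/
noncomputable def sw : AA := renameEquiv k (Equiv.swap 0 1)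

theorem sw_X0 : (sw : AA) (X 0) = X 1 := by simp [sw]
theorem sw_X1 : (sw : AA) (X 1) = X 0 := by simp [sw]
theorem sw_sw : (sw * sw : AA) = 1 := by
  apply aut_ext <;> simp [AlgEquiv.mul_apply, sw_X0, sw_X1]
theorem sw_sw_apply (u : RR) : sw (sw u) = u := by
  rw [← AlgEquiv.mul_apply, sw_sw, AlgEquiv.one_apply]
theorem sw_aff : IsAff (sw : AA) := by
  constructor
  · rw [sw_X0, totalDegree_X]
  · rw [sw_X1, totalDegree_X]

theorem sw_supp (f : RR) (s : Fin 2 →₀ ℕ) (hs : s ∈ f.support) :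
    ∃ t ∈ (sw f).support, t 0 = s 1 ∧ t 1 = s 0 := by
  classical
  refine ⟨Finsupp.mapDomain (Equiv.swap 0 1) s, ?_, ?_, ?_⟩
  · have h : (sw f) = rename (Equiv.swap 0 1) f := rfl
    rw [h, mem_support_iff, coeff_rename_mapDomain _ (Equiv.injective _)]
    exact mem_support_iff.mp hs
  · have := Finsupp.mapDomain_apply (f := Equiv.swap (0 : Fin 2) 1) (Equiv.injective _) s 1
    simpa using this
  · have := Finsupp.mapDomain_apply (f := Equiv.swap (0 : Fin 2) 1) (Equiv.injective _) s 0
    simpa using this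

theorem el_neg_el (p : Polynomial k) (f : RR) : el (-p) (el p f) = f := by
  have := el_mul_neg (-p)
  rw [neg_neg] at this
  rw [← AlgEquiv.mul_apply, this, AlgEquiv.one_apply]

theorem claimC [CharZero k] [IsAlgClosed k] (N : ℕ) : ∀ (σ : AA) (f : RR),
    (σ (X 1)).totalDegree ≤ N → (σ (X 0)).totalDegree < (σ (X 1)).totalDegree →
    0 < f.totalDegree → (∃ s ∈ f.support, wt 1 1 s = f.totalDegree ∧ s 0 ≤ s 1) →
    f.totalDegree < (σ f).totalDegree := by
  induction N with
  | zero => intro σ f h1 h2; omega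
  | succ N ih =>
    intro σ f hN hlt hd ⟨s, hs, hsd, hs01⟩
    obtain ⟨p, hp2, -, hp⟩ := red σ hlt
    have hσ : σ f = (σ * el (-p)) (el p f) := by rw [AlgEquiv.mul_apply, el_neg_el]
    have h1 : f.totalDegree < (el p f).totalDegree := by
      by_contra hcon
      push Not at hcon
      have h3 := lemL f p hp2 hcon s hs hsd
      simp only [wt, mul_one] at hsd
      omega
    rw [hσ]
    have hX0 := mul_el_X0 σ (-p)
    rcases hp with h2 | ⟨h2, h3⟩
    · refine h1.trans ?_
      have hf0 : el p f ≠ 0 := by intro h; rw [h] at h1; simp at h1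
      obtain ⟨t, ht, htd⟩ := exists_deg (el p f) hf0
      have h4 := lemL (el p f) (-p) (by simpa using hp2) (by rw [el_neg_el]; exact h1.le) t ht htd
      obtain ⟨t', ht', e1, e2⟩ := sw_supp _ t ht
      have h5 := ih (σ * el (-p) * sw) (sw (el p f))
        (by rw [AlgEquiv.mul_apply, sw_X1, hX0]; omega)
        (by rw [AlgEquiv.mul_apply, AlgEquiv.mul_apply _ sw, sw_X1, sw_X0, hX0]; exact h2)
        (by rw [aff_deg _ sw_aff]; omega)
        ⟨t', ht', by rw [aff_deg _ sw_aff]; simp only [wt] at htd ⊢; omega, by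
          simp only [wt] at htd; omega⟩
      rwa [AlgEquiv.mul_apply _ sw, sw_sw_apply, aff_deg _ sw_aff] at h5
    · rw [aff_deg _ ⟨by rw [hX0]; exact h2, h3⟩]
      exact h1

theorem P_zero [CharZero k] [IsAlgClosed k] (σ : AA) (f : RR) (hd : 0 < f.totalDegree)
    (hmin : ∀ φ : AA, f.totalDegree ≤ (φ f).totalDegree) (hσ : (σ f).totalDegree = f.totalDegree)
    (hlt : (σ (X 0)).totalDegree < (σ (X 1)).totalDegree) : (σ (X 0)).totalDegree = 1 := by
  obtain ⟨p, hp2, -, hp⟩ := red σ hlt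
  rcases hp with h2 | ⟨h2, h3⟩
  swap
  · exact h2
  exfalso
  have hσ' : σ f = (σ * el (-p)) (el p f) := by rw [AlgEquiv.mul_apply, el_neg_el]
  have h1 : f.totalDegree ≤ (el p f).totalDegree := hmin _
  have hX0 := mul_el_X0 σ (-p)
  have hf0 : el p f ≠ 0 := by intro h; rw [h] at h1; simp at h1; omega
  obtain ⟨t, ht, htd⟩ := exists_deg (el p f) hf0
  have h4 := lemL (el p f) (-p) (by simpa using hp2) (by rw [el_neg_el]; exact h1) t ht htd
  obtain ⟨t', ht', e1, e2⟩ := sw_supp _ t ht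
  have h5 := claimC _ (σ * el (-p) * sw) (sw (el p f)) le_rfl
    (by rw [AlgEquiv.mul_apply, AlgEquiv.mul_apply _ sw, sw_X1, sw_X0, hX0]; exact h2)
    (by rw [aff_deg _ sw_aff]; omega)
    ⟨t', ht', by rw [aff_deg _ sw_aff]; simp only [wt] at htd ⊢; omega, by
      simp only [wt] at htd; omega⟩
  rw [AlgEquiv.mul_apply _ sw, sw_sw_apply, aff_deg _ sw_aff, ← hσ'] at h5
  omega

theorem norm_form [CharZero k] [IsAlgClosed k] (σ : AA) (h : ¬ IsAff σ) :
    ∃ α : AA, IsAff α ∧ ((σ * α) (X 0)).totalDegree < ((σ * α) (X 1)).totalDegree := by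
  rcases lt_trichotomy (σ (X 0)).totalDegree (σ (X 1)).totalDegree with h1 | h1 | h1
  · exact ⟨1, ⟨by simp, by simp⟩, by simpa using h1⟩
  · have h2 : 2 ≤ (σ (X 1)).totalDegree := by
      have := sigma_X_pos σ 0
      by_contra h3
      exact h ⟨by omega, by omega⟩
    obtain ⟨c, hc⟩ := pow_rel σ 1 h2 (by omega)
    refine ⟨el (-(Polynomial.C c * Polynomial.X)) * sw, aff_mul _ _ ⟨?_, ?_⟩ sw_aff, ?_⟩
    · rw [el_X0, totalDegree_X]
    · have hle : (el (-(Polynomial.C c * Polynomial.X)) (X 1 : RR)).totalDegree ≤ 1 := by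
        rw [el_X1]
        refine (totalDegree_add _ _).trans (max_le (totalDegree_X _).le ?_)
        rw [totalDegree_aeval_eq _ (by rw [totalDegree_X]; exact one_pos), totalDegree_X, mul_one,
          Polynomial.natDegree_neg]
        exact (Polynomial.natDegree_C_mul_le _ _).trans Polynomial.natDegree_X_le
      have := sigma_X_pos (el (-(Polynomial.C c * Polynomial.X))) 1
      omega
    · rw [← mul_assoc, AlgEquiv.mul_apply _ sw, AlgEquiv.mul_apply _ sw, sw_X0, sw_X1, mul_el_X0,
        mul_el_X1]
      have e : σ (X 1) + Polynomial.aeval (σ (X 0)) (-(Polynomial.C c * Polynomial.X)) =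
          σ (X 1) - C c * σ (X 0) ^ 1 := by
        simp only [map_neg, map_mul, Polynomial.aeval_C, Polynomial.aeval_X]
        have : algebraMap k RR c = C c := rfl
        rw [this]; ring
      rw [e]; omega
  · exact ⟨sw, sw_aff, by
      rw [AlgEquiv.mul_apply, AlgEquiv.mul_apply, sw_X0, sw_X1]; exact h1⟩

/-- some degree-one form is sent to a degree-one form -/
def PP (σ : AA) : Prop := ∃ l : RR, l.totalDegree = 1 ∧ (σ l).totalDegree = 1

theorem P_main [CharZero k] [IsAlgClosed k] (σ : AA) (f : RR) (hd : 0 < f.totalDegree)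
    (hmin : ∀ φ : AA, f.totalDegree ≤ (φ f).totalDegree) (hσ : (σ f).totalDegree = f.totalDegree) :
    PP σ := by
  by_cases ha : IsAff σ
  · exact ⟨X 0, totalDegree_X _, ha.1⟩
  obtain ⟨α, hα, hlt⟩ := norm_form σ ha
  have h1 : (α⁻¹ f).totalDegree = f.totalDegree := aff_deg _ (aff_inv α hα) f
  refine ⟨α (X 0), hα.1, ?_⟩
  refine P_zero (σ * α) (α⁻¹ f) (by omega) ?_ ?_ hlt
  · intro φ; rw [h1, ← AlgEquiv.mul_apply]; exact hmin _
  · rw [h1, ← AlgEquiv.mul_apply, mul_inv_cancel_right, hσ]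

end ClaimC


section GroupArg

theorem lin_form (u : RR) (hu : u.totalDegree ≤ 1) :
    ∃ a b c : k, u = C a * X 0 + C b * X 1 + C c := by
  classical
  refine ⟨coeff (Finsupp.single 0 1) u, coeff (Finsupp.single 1 1) u, coeff 0 u, ?_⟩
  ext s
  rw [coeff_add, coeff_add, coeff_C_mul, coeff_C_mul, coeff_C, coeff_X, coeff_X]
  have h10 : (Finsupp.single (1 : Fin 2) 1 : Fin 2 →₀ ℕ) ≠ Finsupp.single 0 1 := by
    intro h; have := DFunLike.congr_fun h 0; simp at this
  by_cases h0 : Finsupp.single 0 1 = s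
  · subst h0
    rw [if_pos rfl, if_neg h10, if_neg (by
      intro h; have := DFunLike.congr_fun h 0; simp at this)]
    simp
  by_cases h1 : Finsupp.single 1 1 = s
  · subst h1
    rw [if_pos rfl, if_neg h0, if_neg (by
      intro h; have := DFunLike.congr_fun h 1; simp at this)]
    simp
  by_cases h2 : 0 = s
  · subst h2
    rw [if_pos rfl, if_neg h0, if_neg h1]
    simp
  rw [if_neg h0, if_neg h1, if_neg h2]
  simp only [mul_zero, add_zero]
  by_contra hne
  have h3 := (le_deg u s (mem_support_iff.mpr hne)).trans hu
  simp only [wt, mul_one] at h3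
  rcases Nat.eq_zero_or_pos (s 0) with h4 | h4
  · rcases Nat.eq_zero_or_pos (s 1) with h5 | h5
    · apply h2; ext i; fin_cases i <;> simp [h4, h5]
    · apply h1; ext i; fin_cases i
      · simp [h4]
      · simp; omega
  · apply h0; ext i; fin_cases i
    · simp; omega
    · simp; omega

theorem deg_lin (u v : RR) (a b c : k) (M : ℕ) (hu : u.totalDegree ≤ M) (hv : v.totalDegree ≤ M) :
    (C a * u + C b * v + C c).totalDegree ≤ M := by
  refine (totalDegree_add _ _).trans (max_le ((totalDegree_add _ _).trans (max_le ?_ ?_)) ?_)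
  · refine (totalDegree_mul _ _).trans ?_
    rw [totalDegree_C]; omega
  · refine (totalDegree_mul _ _).trans ?_
    rw [totalDegree_C]; omega
  · rw [totalDegree_C]; omega

theorem sigma_lin (σ : AA) (u v : RR) (a b c : k) :
    σ (C a * u + C b * v + C c) = C a * σ u + C b * σ v + C c := by
  simp only [map_add, map_mul, sigma_C]

theorem lin_form_aff [CharZero k] (α : AA) (hα : IsAff α) (u : RR) (hu : u.totalDegree ≤ 1) :
    ∃ a b c : k, u = C a * α (X 0) + C b * α (X 1) + C c := by
  obtain ⟨a, b, c, h⟩ := lin_form (α⁻¹ u) (by rwa [aff_deg _ (aff_inv α hα)])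
  refine ⟨a, b, c, ?_⟩
  rw [← sigma_lin, ← h, ← AlgEquiv.mul_apply, mul_inv_cancel, AlgEquiv.one_apply]

theorem exists_aff_aux (l : RR) (a b c : k) (ha : a ≠ 0) (hl : l = C a * X 0 + C b * X 1 + C c)
    (hl1 : l.totalDegree = 1) : ∃ α : AA, IsAff α ∧ α (X 0) = l := by
  have hca : (C a⁻¹ * C a : RR) = 1 := by rw [← C_mul, inv_mul_cancel₀ ha, C_1]
  let φ : RR →ₐ[k] RR := aeval ![C a * X 0 + C b * X 1 + C c, X 1]
  let ψ : RR →ₐ[k] RR := aeval ![C a⁻¹ * (X 0 - C b * X 1 - C c), X 1]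
  have hC : ∀ (χ : RR →ₐ[k] RR) (c : k), χ (C c) = C c := fun χ c => χ.commutes c
  have φ0 : φ (X 0) = C a * X 0 + C b * X 1 + C c := by simp [φ]
  have φ1 : φ (X 1) = X 1 := by simp [φ]
  have ψ0 : ψ (X 0) = C a⁻¹ * (X 0 - C b * X 1 - C c) := by simp [ψ]
  have ψ1 : ψ (X 1) = X 1 := by simp [ψ]
  have h1 : φ.comp ψ = AlgHom.id k RR := by
    apply MvPolynomial.algHom_ext
    intro i; fin_cases i
    · simp only [AlgHom.comp_apply, Fin.zero_eta, AlgHom.id_apply]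
      rw [ψ0]; simp only [map_mul, map_sub, hC, φ0, φ1]
      linear_combination (X 0) * hca
    · simp only [AlgHom.comp_apply, Fin.mk_one, AlgHom.id_apply]
      rw [ψ1, φ1]
  have h2 : ψ.comp φ = AlgHom.id k RR := by
    apply MvPolynomial.algHom_ext
    intro i; fin_cases i
    · simp only [AlgHom.comp_apply, Fin.zero_eta, AlgHom.id_apply]
      rw [φ0]; simp only [map_mul, map_add, hC, ψ0, ψ1]
      linear_combination (X 0 - C b * X 1 - C c) * hca
    · simp only [AlgHom.comp_apply, Fin.mk_one, AlgHom.id_apply]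
      rw [φ1, ψ1]
  refine ⟨AlgEquiv.ofAlgHom φ ψ h1 h2, ⟨?_, ?_⟩, ?_⟩
  · change (φ (X 0)).totalDegree = 1
    rw [φ0, ← hl, hl1]
  · change (φ (X 1)).totalDegree = 1
    rw [φ1, totalDegree_X]
  · change φ (X 0) = l
    rw [φ0, hl]

theorem exists_aff [CharZero k] (l : RR) (hl1 : l.totalDegree = 1) :
    ∃ α : AA, IsAff α ∧ α (X 0) = l := by
  obtain ⟨a, b, c, h⟩ := lin_form l hl1.le
  by_cases ha : a = 0
  · by_cases hb : b = 0
    · exfalso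
      rw [h, ha, hb] at hl1
      simp at hl1
    · obtain ⟨α, h1, h2⟩ := exists_aff_aux (sw l) b a c hb (by
        rw [h, sigma_lin, sw_X0, sw_X1]; ring) (by rw [aff_deg _ sw_aff, hl1])
      exact ⟨sw * α, aff_mul _ _ sw_aff h1, by rw [AlgEquiv.mul_apply, h2, sw_sw_apply]⟩
  · exact exists_aff_aux l a b c ha h hl1

theorem uniq_line [CharZero k] (σ : AA) (hσ : ¬ IsAff σ) (u v : RR) (hu : u.totalDegree = 1)
    (hv : v.totalDegree = 1) (hu' : (σ u).totalDegree = 1) (hv' : (σ v).totalDegree = 1) :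
    ∃ a c : k, a ≠ 0 ∧ v = C a * u + C c := by
  obtain ⟨α, hα, hα0⟩ := exists_aff u hu
  obtain ⟨a, b, c, h⟩ := lin_form_aff α hα v hv.le
  rw [hα0] at h
  by_cases hb : b = 0
  · refine ⟨a, c, ?_, ?_⟩
    · rintro rfl
      rw [h, hb] at hv; simp at hv
    · rw [h, hb]; simp
  exfalso
  have hlam : (σ (α (X 1))).totalDegree ≤ 1 := by
    have e : σ (α (X 1)) = C b⁻¹ * σ v + C (-(b⁻¹ * a)) * σ u + C (-(b⁻¹ * c)) := by
      rw [h, sigma_lin]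
      have : (C b⁻¹ * C b : RR) = 1 := by rw [← C_mul, inv_mul_cancel₀ hb, C_1]
      simp only [C_neg, C_mul]
      linear_combination -(σ (α (X 1))) * this
    rw [e]; exact deg_lin _ _ _ _ _ _ hv'.le hu'.le
  have : ∀ i : Fin 2, (σ (X i)).totalDegree = 1 := by
    intro i
    apply le_antisymm _ (sigma_X_pos σ i)
    obtain ⟨a, b, c, h⟩ := lin_form_aff α hα (X i) (totalDegree_X _).le
    rw [h, sigma_lin]
    refine deg_lin _ _ _ _ _ _ ?_ hlam
    rw [hα0, hu']
  exact hσ ⟨this 0, this 1⟩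

theorem DJ [CharZero k] [IsAlgClosed k] (τ : AA) (h : (τ (X 0)).totalDegree = 1) :
    ∃ (p : Polynomial k) (Q : RR), τ (X 1) = Polynomial.aeval (τ (X 0)) p + Q ∧
      p.natDegree ≤ (τ (X 1)).totalDegree ∧ Q.totalDegree ≤ 1 ∧
      (2 ≤ (τ (X 1)).totalDegree → 2 ≤ p.natDegree) := by
  by_cases h2 : (τ (X 1)).totalDegree ≤ 1
  · exact ⟨0, τ (X 1), by simp, by simp, h2, fun h => by omega⟩
  obtain ⟨p, hp2, hple, hp⟩ := red τ (by omega)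
  refine ⟨p, (τ * el (-p)) (X 1), ?_, hple, ?_, fun _ => hp2⟩
  · rw [mul_el_X1, map_neg]; ring
  · rcases hp with h | h <;> omega

/-- Fact 2 -/
theorem fact_two [CharZero k] [IsAlgClosed k] (σ τ : AA) (hσ : PP σ) (hτ : ¬ IsAff τ)
    (hστ : PP (σ * τ)) (l : RR) (hl : l.totalDegree = 1) (hl' : (τ l).totalDegree = 1) :
    (σ (τ l)).totalDegree = 1 := by
  by_contra hM
  have hM2 : 2 ≤ (σ (τ l)).totalDegree := by
    have := sigma_deg_pos (σ * τ) l (by omega)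
    rw [AlgEquiv.mul_apply] at this
    omega
  set M := (σ (τ l)).totalDegree with hMdef
  obtain ⟨α, hα, hα0⟩ := exists_aff l hl
  obtain ⟨p, Q, e, -, hQ, hp⟩ := DJ (τ * α) (by rw [AlgEquiv.mul_apply, hα0, hl'])
  rw [AlgEquiv.mul_apply, AlgEquiv.mul_apply, hα0] at e
  have hn : 2 ≤ p.natDegree := by
    apply hp
    by_contra hcon
    apply hτ
    have : ∀ i : Fin 2, (τ (X i)).totalDegree = 1 := by
      intro i
      apply le_antisymm _ (sigma_X_pos τ i)
      obtain ⟨a, b, c, h⟩ := lin_form_aff α hα (X i) (totalDegree_X _).le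
      rw [h, sigma_lin]
      rw [AlgEquiv.mul_apply] at hcon
      refine deg_lin _ _ _ _ _ _ ?_ (by omega)
      rw [hα0, hl']
    exact ⟨this 0, this 1⟩
  have hσQ : (σ Q).totalDegree ≤ M := by
    obtain ⟨m, hm, hm'⟩ := hσ
    obtain ⟨β, hβ, hβ0⟩ := exists_aff m hm
    obtain ⟨a, b, c, h⟩ := lin_form_aff β hβ (τ l) hl'.le
    have hb : b ≠ 0 := by
      rintro rfl
      have : (σ (τ l)).totalDegree ≤ 1 := by
        rw [h, hβ0, C_0, zero_mul, add_zero]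
        have := deg_lin (σ m) (σ m) a 0 c 1 hm'.le hm'.le
        simpa [sigma_C] using this
      omega
    have hlam : (σ (β (X 1))).totalDegree ≤ M := by
      have e : σ (β (X 1)) = C b⁻¹ * σ (τ l) + C (-(b⁻¹ * a)) * σ m + C (-(b⁻¹ * c)) := by
        rw [h, sigma_lin, hβ0]
        have : (C b⁻¹ * C b : RR) = 1 := by rw [← C_mul, inv_mul_cancel₀ hb, C_1]
        simp only [C_neg, C_mul]
        linear_combination -(σ (β (X 1))) * this
      rw [e]; exact deg_lin _ _ _ _ _ _ le_rfl (by omega)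
    obtain ⟨a, b, c, h⟩ := lin_form_aff β hβ Q hQ
    rw [h, sigma_lin]
    exact deg_lin _ _ _ _ _ _ (by rw [hβ0]; omega) hlam
  obtain ⟨l', hl1, hl2⟩ := hστ
  obtain ⟨a, b, c, h⟩ := lin_form_aff α hα l' hl1.le
  rw [AlgEquiv.mul_apply, h, sigma_lin, sigma_lin, hα0, e, map_add, sigma_aeval] at hl2
  have hpd := totalDegree_aeval_eq (σ (τ l)) (by omega) p
  rw [← hMdef] at hpd
  have hbig : M < p.natDegree * M := by nlinarith
  by_cases hb : b = 0
  · subst hb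
    have ha : a ≠ 0 := by rintro rfl; simp at hl2
    have : (σ (τ l)).totalDegree ≤ 1 := by
      have e : σ (τ l) = C a⁻¹ * (C a * σ (τ l) + C 0 * (Polynomial.aeval (σ (τ l)) p + σ Q) + C c)
          + C 0 * 0 + C (-(a⁻¹ * c)) := by
        have : (C a⁻¹ * C a : RR) = 1 := by rw [← C_mul, inv_mul_cancel₀ ha, C_1]
        simp only [C_neg, C_mul, C_0]
        linear_combination -(σ (τ l)) * this
      rw [e]; exact deg_lin _ _ _ _ _ _ hl2.le (by simp)
    omega
  · have e : Polynomial.aeval (σ (τ l)) p = C b⁻¹ * (C a * σ (τ l) +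
        C b * (Polynomial.aeval (σ (τ l)) p + σ Q) + C c) + C (-1) * (C (b⁻¹ * a) * σ (τ l) + C 1 * σ Q
          + C 0)
          + C (-(b⁻¹ * c)) := by
      have : (C b⁻¹ * C b : RR) = 1 := by rw [← C_mul, inv_mul_cancel₀ hb, C_1]
      simp only [C_neg, C_mul, C_0, C_1]
      linear_combination -(Polynomial.aeval (σ (τ l)) p + σ Q) * this
    have : (Polynomial.aeval (σ (τ l)) p).totalDegree ≤ M := by
      rw [e]
      exact deg_lin _ _ _ _ _ _ (by omega) (deg_lin _ _ _ _ _ _ le_rfl hσQ)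
    omega

end GroupArg


section Bdd

theorem aff_part (σ : AA) (u v : RR) (a c : k) (ha : a ≠ 0) (h : v = C a * u + C c) :
    (σ v).totalDegree = (σ u).totalDegree := by
  apply le_antisymm
  · have := deg_lin (σ u) 0 a 0 c _ le_rfl (by simp)
    simpa [h, sigma_C] using this
  · have e : σ u = C a⁻¹ * σ v + C 0 * 0 + C (-(a⁻¹ * c)) := by
      have : (C a⁻¹ * C a : RR) = 1 := by rw [← C_mul, inv_mul_cancel₀ ha, C_1]
      rw [h]
      simp only [C_neg, C_0, map_add, map_mul, sigma_C]
      linear_combination -(σ u) * this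
    rw [e]
    exact deg_lin _ _ _ _ _ _ le_rfl (by simp)

theorem inv_line [CharZero k] [IsAlgClosed k] (Γ : Subgroup AA) (h : ∀ σ ∈ Γ, PP σ)
    (hna : ∃ σ ∈ Γ, ¬ IsAff σ) :
    ∃ l : RR, l.totalDegree = 1 ∧ ∀ σ ∈ Γ, (σ l).totalDegree = 1 := by
  obtain ⟨σ₀, hσ₀, hn₀⟩ := hna
  obtain ⟨l, hl, hl'⟩ := h σ₀ hσ₀
  have h1 : ∀ σ ∈ Γ, (σ (σ₀ l)).totalDegree = 1 := fun σ hσ =>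
    fact_two σ σ₀ (h σ hσ) hn₀ (h _ (Γ.mul_mem hσ hσ₀)) l hl hl'
  obtain ⟨a, c, ha, e⟩ := uniq_line σ₀ hn₀ l (σ₀ l) hl hl' hl' (h1 σ₀ hσ₀)
  exact ⟨l, hl, fun σ hσ => by rw [← aff_part σ l (σ₀ l) a c ha e]; exact h1 σ hσ⟩

theorem bdd_PP [CharZero k] [IsAlgClosed k] (Γ : Subgroup AA) (hfg : Γ.FG) (h : ∀ σ ∈ Γ, PP σ) :
    ∃ N : ℕ, ∀ φ ∈ Γ, adeg φ ≤ N := by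
  by_cases hna : ∃ σ ∈ Γ, ¬ IsAff σ
  swap
  · push Not at hna
    exact ⟨1, fun φ hφ => max_le (hna φ hφ).1.le (hna φ hφ).2.le⟩
  obtain ⟨l, hl, hΓl⟩ := inv_line Γ h hna
  obtain ⟨α, hα, hα0⟩ := exists_aff l hl
  obtain ⟨S, rfl⟩ := hfg
  have hM : ∃ M : ℕ, 1 ≤ M ∧ ∀ s ∈ S, (s (α (X 1))).totalDegree ≤ M ∧ (s⁻¹ (α (X 1))).totalDegree ≤ M := by
    refine ⟨1 + ∑ s ∈ S, ((s (α (X 1))).totalDegree + (s⁻¹ (α (X 1))).totalDegree), by omega, ?_⟩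
    intro s hs
    have := Finset.single_le_sum (f := fun s : AA => (s (α (X 1))).totalDegree + (s⁻¹ (α (X 1))).totalDegree)
      (fun _ _ => Nat.zero_le _) hs
    omega
  obtain ⟨M, hM1, hM⟩ := hM
  have step : ∀ s ∈ Subgroup.closure (S : Set AA), (s (α (X 1))).totalDegree ≤ M →
      ∀ σ ∈ Subgroup.closure (S : Set AA), (σ (α (X 1))).totalDegree ≤ M →
      ((s * σ) (α (X 1))).totalDegree ≤ M := by
    intro s hs hsM σ hσ hσM
    obtain ⟨p, Q, e, hp, hQ, -⟩ := DJ (σ * α) (by rw [AlgEquiv.mul_apply, hα0]; exact hΓl σ hσ)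
    rw [AlgEquiv.mul_apply, AlgEquiv.mul_apply, hα0] at e
    rw [AlgEquiv.mul_apply] at hp
    rw [AlgEquiv.mul_apply, e, map_add, sigma_aeval]
    refine (totalDegree_add _ _).trans (max_le ?_ ?_)
    · have h1 : (s (σ l)).totalDegree = 1 := hΓl _ (mul_mem hs hσ)
      rw [totalDegree_aeval_eq _ (by omega), h1]
      omega
    · obtain ⟨a, b, c, h⟩ := lin_form_aff α hα Q hQ
      rw [h, sigma_lin]
      refine deg_lin _ _ _ _ _ _ ?_ hsM
      rw [hα0, hΓl s hs]; exact hM1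
  have hall : ∀ σ ∈ Subgroup.closure (S : Set AA), (σ (α (X 1))).totalDegree ≤ M := by
    intro σ hσ
    induction hσ using Subgroup.closure_induction_left with
    | one => rw [AlgEquiv.one_apply, hα.2]; exact hM1
    | mul_left x hx y hy ih => exact step x (Subgroup.subset_closure hx) (hM x hx).1 y hy ih
    | inv_mul_cancel x hx y hy ih =>
      exact step x⁻¹ (inv_mem (Subgroup.subset_closure hx)) (hM x hx).2 y hy ih
  refine ⟨M, fun σ hσ => ?_⟩
  have : ∀ i : Fin 2, (σ (X i)).totalDegree ≤ M := by
    intro i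
    obtain ⟨a, b, c, h⟩ := lin_form_aff α hα (X i) (totalDegree_X _).le
    rw [h, sigma_lin]
    refine deg_lin _ _ _ _ _ _ ?_ (hall σ hσ)
    rw [hα0, hΓl σ hσ]; exact hM1
  exact max_le (this 0) (this 1)

theorem adeg_mul (σ τ : AA) : adeg (σ * τ) ≤ adeg σ * adeg τ := by
  have h : ∀ u, (σ u).totalDegree ≤ adeg σ * u.totalDegree := fun u =>
    aff_le σ (adeg σ) (le_max_left _ _) (le_max_right _ _) u
  apply max_le
  · exact (h _).trans (Nat.mul_le_mul_left _ (le_max_left _ _))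
  · exact (h _).trans (Nat.mul_le_mul_left _ (le_max_right _ _))

/-- a finitely generated group with a nonconstant polynomial of invariant degree class is bounded -/
theorem bdd_main [CharZero k] [IsAlgClosed k] (Γ : Subgroup AA) (hfg : Γ.FG) (g : RR)
    (hg : 0 < g.totalDegree) (hΓ : ∀ σ ∈ Γ, Associated (σ g) g) :
    ∃ N : ℕ, ∀ φ ∈ Γ, adeg φ ≤ N := by
  obtain ⟨ψ, hψ⟩ : ∃ ψ : AA, ∀ φ : AA, (ψ g).totalDegree ≤ (φ g).totalDegree := by
    let S : Set ℕ := Set.range fun φ : AA => (φ g).totalDegree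
    have hS : S.Nonempty := ⟨_, 1, rfl⟩
    obtain ⟨p, hp⟩ := WellFounded.min_mem Nat.lt_wfRel.wf S hS
    exact ⟨p, fun q => hp.le.trans (not_lt.mp (WellFounded.not_lt_min Nat.lt_wfRel.wf S ⟨q, rfl⟩))⟩
  have hg0 : g ≠ 0 := by rintro rfl; simp at hg
  have hassoc : ∀ u v : RR, v ≠ 0 → Associated u v → u.totalDegree = v.totalDegree := by
    intro u v hv huv
    obtain ⟨w, hw⟩ := huv
    obtain ⟨c, hc, hcw⟩ := (MvPolynomial.isUnit_iff_eq_C_of_isReduced.mp w.isUnit)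
    rw [← hw, totalDegree_mul_of_isDomain, hcw, totalDegree_C, add_zero]
    · rintro rfl; simp at hw; exact hv hw.symm
    · exact w.ne_zero
  have hfg' : (Γ.map (MulAut.conj ψ).toMonoidHom).FG := by
    classical
    obtain ⟨S, hS⟩ := hfg
    refine ⟨S.image (MulAut.conj ψ).toMonoidHom, ?_⟩
    rw [← hS, MonoidHom.map_closure, Finset.coe_image]
  obtain ⟨N, hN⟩ := bdd_PP (Γ.map (MulAut.conj ψ).toMonoidHom) hfg' (by
    rintro _ ⟨σ, hσ, rfl⟩
    refine P_main _ (ψ g) (sigma_deg_pos ψ g hg) (fun φ => ?_) ?_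
    · rw [← AlgEquiv.mul_apply]; exact hψ _
    · change ((ψ * σ * ψ⁻¹) (ψ g)).totalDegree = _
      rw [← AlgEquiv.mul_apply, inv_mul_cancel_right, AlgEquiv.mul_apply]
      apply hassoc _ _ (by simpa using hg0)
      exact (hΓ σ hσ).map (ψ : RR →* RR))
  refine ⟨adeg ψ⁻¹ * N * adeg ψ, fun φ hφ => ?_⟩
  have h1 := hN (ψ * φ * ψ⁻¹) ⟨φ, hφ, rfl⟩
  have h2 : φ = ψ⁻¹ * (ψ * φ * ψ⁻¹) * ψ := by group
  calc adeg φ = adeg (ψ⁻¹ * (ψ * φ * ψ⁻¹) * ψ) := by rw [← h2]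
    _ ≤ adeg (ψ⁻¹ * (ψ * φ * ψ⁻¹)) * adeg ψ := adeg_mul _ _
    _ ≤ adeg ψ⁻¹ * adeg (ψ * φ * ψ⁻¹) * adeg ψ := Nat.mul_le_mul_right _ (adeg_mul _ _)
    _ ≤ _ := by gcongr

end Bdd


section Final

theorem fin_zeros (q h : RR) (hq : Irreducible q) (hqh : ¬ q ∣ h) :
    {x : Fin 2 → k | eval x q = 0 ∧ eval x h = 0}.Finite := by
  let J : Ideal RR := Ideal.span {q, h}
  let m : (Fin 2 → k) → Ideal RR := fun x => RingHom.ker (eval x)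
  have hmprime : ∀ x, (m x).IsPrime := fun x => RingHom.ker_isPrime _
  have hdim : ringKrullDim RR = 2 := by
    rw [MvPolynomial.ringKrullDim_of_isNoetherianRing, ringKrullDim_eq_zero_of_field]
    simp
  have hqprime : (Ideal.span {q} : Ideal RR).IsPrime :=
    (Ideal.span_singleton_prime hq.ne_zero).mpr hq.prime
  have hfin : (J.minimalPrimes).Finite := J.finite_minimalPrimes_of_isNoetherianRing RR
  refine Set.Finite.of_finite_image (f := m) (hfin.subset ?_) ?_
  · rintro _ ⟨x, ⟨hx1, hx2⟩, rfl⟩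
    have := hmprime x
    have hJ : J ≤ m x := by
      rw [Ideal.span_le]
      rintro u (rfl | rfl)
      · exact hx1
      · exact hx2
    obtain ⟨P, hP, hPm⟩ := Ideal.exists_minimalPrimes_le hJ
    have hPp : P.IsPrime := hP.1.1
    have hPJ : J ≤ P := hP.1.2
    rcases eq_or_lt_of_le hPm with e | hlt
    · rwa [e] at hP
    exfalso
    have l0 : (⊥ : Ideal RR) < Ideal.span {q} := by
      rw [bot_lt_iff_ne_bot, Ne, Ideal.span_singleton_eq_bot]; exact hq.ne_zero
    have l1 : (Ideal.span {q} : Ideal RR) < P := by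
      refine lt_of_le_of_ne ?_ ?_
      · rw [Ideal.span_singleton_le_iff_mem]
        exact hPJ (Ideal.subset_span (by simp))
      · intro e
        apply hqh
        rw [← Ideal.mem_span_singleton, e]
        exact hPJ (Ideal.subset_span (by simp))
    have hb : (⊥ : Ideal RR).IsPrime := Ideal.isPrime_bot
    have h0 := Ideal.height_add_one_le_of_lt_of_isPrime l0
    have h1 := Ideal.height_add_one_le_of_lt_of_isPrime l1
    have h2 := Ideal.height_add_one_le_of_lt_of_isPrime hlt
    have h3 := Ideal.height_le_ringKrullDim_of_isPrime (I := m x)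
    rw [hdim] at h3
    have h3' : (m x).height ≤ 2 := by
      have e2 : (2 : WithBot ℕ∞) = ((2 : ℕ∞) : WithBot ℕ∞) := rfl
      rw [e2] at h3
      exact WithBot.coe_le_coe.mp h3
    rw [Ideal.height_bot] at h0
    have h4 : (0 : ℕ∞) + 1 + 1 + 1 ≤ 2 :=
      ((add_le_add_left ((add_le_add_left h0 1).trans h1) 1).trans h2).trans h3'
    revert h4; decide
  · intro x _ y _ hxy
    funext i
    have h1 : (X i - C (x i) : RR) ∈ m x := by simp [m, RingHom.mem_ker]
    have h2 : m x = m y := hxy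
    rw [h2] at h1
    have h3 : eval y (X i - C (x i) : RR) = 0 := h1
    simp at h3
    exact (sub_eq_zero.mp h3).symm

theorem eval_pmap (σ : AA) (p : Fin 2 → k) (f : RR) : eval (pmap σ p) f = eval p (σ f) := by
  have : ((aeval p : RR →ₐ[k] k).comp (σ : RR →ₐ[k] RR)) = aeval (pmap σ p) := by
    apply MvPolynomial.algHom_ext
    intro i
    simp [pmap, aeval_eq_eval]
  have h := DFunLike.congr_fun this f
  simp only [AlgHom.comp_apply, aeval_eq_eval] at h
  exact h.symm

theorem exists_semi (Γ : Subgroup AA) (p : Fin 2 → k)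
    (hinf : ¬ {q | ∃ φ ∈ Γ, q = pmap φ p}.Finite) (f : RR) (hf : f ≠ 0)
    (hv : ∀ φ ∈ Γ, eval p (φ f) = 0) :
    ∃ g : RR, 0 < g.totalDegree ∧ ∀ σ ∈ Γ, Associated (σ g) g := by
  classical
  let I : Ideal RR :=
    { carrier := {u | ∀ φ ∈ Γ, eval p (φ u) = 0}
      add_mem' := by
        intro a b ha hb φ hφ
        rw [map_add, map_add, ha φ hφ, hb φ hφ, add_zero]
      zero_mem' := by intro φ _; simp
      smul_mem' := by
        intro c u hu φ hφ
        rw [smul_eq_mul, map_mul, map_mul, hu φ hφ, mul_zero] }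
  have hI : ∀ u, u ∈ I ↔ ∀ φ ∈ Γ, eval p (φ u) = 0 := fun u => Iff.rfl
  have hIσ : ∀ σ ∈ Γ, ∀ u ∈ I, σ u ∈ I := by
    intro σ hσ u hu φ hφ
    rw [← AlgEquiv.mul_apply]; exact hu _ (Γ.mul_mem hφ hσ)
  obtain ⟨S, hS⟩ : I.FG := IsNoetherian.noetherian I
  letI : NormalizedGCDMonoid RR := Classical.choice inferInstance
  set g : RR := S.gcd id with hg
  have hgI : ∀ u ∈ I, g ∣ u := by
    intro u hu
    rw [← Ideal.mem_span_singleton]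
    have : I ≤ Ideal.span {g} := by
      rw [← hS]
      refine Ideal.span_le.mpr fun v hv => ?_
      exact Ideal.mem_span_singleton.mpr (Finset.gcd_dvd hv)
    exact this hu
  have hgmax : ∀ d, (∀ u ∈ I, d ∣ u) → d ∣ g := by
    intro d hd
    refine Finset.dvd_gcd fun b hb => hd _ ?_
    rw [← hS]; exact Ideal.subset_span hb
  have hσg : ∀ σ ∈ Γ, σ g ∣ g := by
    intro σ hσ
    apply hgmax
    intro u hu
    have h1 := map_dvd σ (hgI _ (hIσ σ⁻¹ (Γ.inv_mem hσ) u hu))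
    rwa [← AlgEquiv.mul_apply, mul_inv_cancel, AlgEquiv.one_apply] at h1
  have hg0 : g ≠ 0 := by
    intro h
    have := hgI f hv
    rw [h, zero_dvd_iff] at this
    exact hf this
  refine ⟨g, ?_, ?_⟩
  · by_contra hdeg
    have hu : IsUnit g := by
      have h0 : g.totalDegree = 0 := by omega
      rw [totalDegree_eq_zero_iff_eq_C] at h0
      rw [h0] at hg0 ⊢
      exact (IsUnit.mk0 _ (by simpa using hg0)).map C
    apply hinf
    have hch : ∀ q : RR, Irreducible q → ∃ h ∈ I, ¬ q ∣ h := by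
      intro q hq
      by_contra hcon
      push Not at hcon
      exact hq.not_isUnit (isUnit_of_dvd_unit (hgmax q hcon) hu)
    let F := UniqueFactorizationMonoid.factors f
    have hirr : ∀ q ∈ F, Irreducible q := fun q hq =>
      UniqueFactorizationMonoid.irreducible_of_factor q hq
    choose! h hhI hhq using hch
    refine Set.Finite.subset (s := ⋃ q ∈ F.toFinset, {x : Fin 2 → k | eval x q = 0 ∧ eval x (h q) = 0})
      (Set.Finite.biUnion (Finset.finite_toSet _) ?_) ?_
    · intro q hq
      have hq' := hirr q (Multiset.mem_toFinset.mp hq)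
      exact fin_zeros q (h q) hq' (hhq q hq')
    · rintro _ ⟨φ, hφ, rfl⟩
      have hprod : F.prod ∣ f := (UniqueFactorizationMonoid.factors_prod hf).dvd
      have hprod' : f ∣ F.prod := (UniqueFactorizationMonoid.factors_prod hf).symm.dvd
      have hz : eval (pmap φ p) f = 0 := by rw [eval_pmap]; exact hv φ hφ
      have hz' : eval (pmap φ p) F.prod = 0 := by
        obtain ⟨c, hc⟩ := hprod'
        rw [hc, map_mul, hz, zero_mul]
      rw [map_multiset_prod, Multiset.prod_eq_zero_iff, Multiset.mem_map] at hz'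
      obtain ⟨q, hq, hq0⟩ := hz'
      simp only [Set.mem_iUnion]
      refine ⟨q, Multiset.mem_toFinset.mpr hq, hq0, ?_⟩
      rw [eval_pmap]
      exact hhI q (hirr q hq) φ hφ
  · intro σ hσ
    refine associated_of_dvd_dvd (hσg σ hσ) ?_
    have h1 := map_dvd σ (hσg σ⁻¹ (Γ.inv_mem hσ))
    rwa [← AlgEquiv.mul_apply, mul_inv_cancel, AlgEquiv.one_apply] at h1

end Final

theorem stmt9 [Algebra ℚ k] [IsAlgClosure ℚ k]
    (Γ : Subgroup (MvPolynomial (Fin 2) k ≃ₐ[k] MvPolynomial (Fin 2) k))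
    (hΓ : Γ.FG)
    (hub : ¬ ∃ N : ℕ, ∀ φ ∈ Γ, adeg φ ≤ N)
    (p : Fin 2 → k) :
    {q : Fin 2 → k | ∃ φ ∈ Γ, q = pmap φ p}.Finite ∨
      ∀ f : MvPolynomial (Fin 2) k,
        (∀ q ∈ {q : Fin 2 → k | ∃ φ ∈ Γ, q = pmap φ p}, eval q f = 0) → f = 0 := by
  have hc : CharZero k := algebraRat.charZero k
  have ha : IsAlgClosed k := IsAlgClosure.isAlgClosed ℚ
  by_cases hfin : {q : Fin 2 → k | ∃ φ ∈ Γ, q = pmap φ p}.Finite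
  · exact Or.inl hfin
  right
  intro f hv
  by_contra hf
  obtain ⟨g, hg, hgΓ⟩ := exists_semi Γ p hfin f hf (fun φ hφ => by
    rw [← eval_pmap]; exact hv _ ⟨φ, hφ, rfl⟩)
  exact hub (bdd_main Γ hΓ g hg hgΓ)
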